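/- arXiv:1401.3395 — 2 statements merged into one kernel-verified Lean document; each statement's English description precedes it below -/
import Mathlib

section
/- Let N ≥ 1 and let x = (x_1,…,x_{2N}) be positive reals satisfying the highest weight condition and Σ_{l=1}^{N} x_{2l−1} > Σ_{l=1}^{N} x_{2l}. Let (μ^{(i)}, ν^{(i)})_{1≤i≤u} and λ^{(i)} = μ^{(1)} + ⋯ + μ^{(i)} be produced by Algorithm A applied to x, and let M be the multiset of N positive reals containing λ^{(i)} with multiplicity ν^{(i)} for each 1 ≤ i ≤ u. Then for every 1 ≤ k ≤ N, the sum of the k smallest elements of M (counted with multiplicity) equals H_k(x) := min over all cyclically sparse subsets S of {1,…,2N} with |S| = k of Σ_{i∈S} x_i. -/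
/-- A finite sequence of nonnegative reals (as a list, 0-indexed) satisfies the
*highest weight condition* if `∑_{i=1}^{k} (x_{2i-1} - x_{2i}) ≥ 0` for all `k`. -/
def HWC (l : List ℝ) : Prop :=
  ∀ k : ℕ, 2 * k ≤ l.length →
    0 ≤ ∑ j ∈ Finset.range k, (l.getD (2 * j) 0 - l.getD (2 * j + 1) 0)

/-- A subset `S` of `{1, …, 2N}` is *cyclically sparse* if any two distinct elements of
`S` differ by at least 2 and not both `1` and `2N` lie in `S`. -/
def CycSparse (N : ℕ) (S : Finset ℕ) : Prop :=
  S ⊆ Finset.Icc 1 (2 * N) ∧ (∀ i ∈ S, ∀ j ∈ S, i < j → i + 2 ≤ j) ∧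
    ¬(1 ∈ S ∧ 2 * N ∈ S)

/-- One pass of zero-elimination on a list of nonnegative reals whose first entry is
positive, processed with explicit fuel (fuel `≥` the length of the list always
suffices).  A trailing run of zeros is deleted together with, if its length is odd, the
positive entry immediately preceding it (returned as the second component); an interior
run of zeros of even length is deleted; an interior run of zeros of odd length is merged
together with its positive neighbours `a, b` into the single entry `a + b`. -/
noncomputable def squashF : ℕ → List ℝ → List ℝ × ℝ
  | 0, _ => ([], 0)
  | _ + 1, [] => ([], 0)
  | fuel + 1, a :: rest =>
    let m := (rest.takeWhile (fun t => decide (t = 0))).length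
    let r := rest.drop m
    if r = [] then (if Even m then ([a], 0) else ([], a))
    else if Even m then
      let p := squashF fuel (r.headI :: r.tail)
      (a :: p.1, p.2)
    else squashF fuel ((a + r.headI) :: r.tail)

/-- Delete the run of zeros at the left end of `y`, then eliminate all remaining runs of
zeros; returns the resulting list together with the positive entry deleted at the right
end (`0` if no entry was deleted there). -/
noncomputable def contract (y : List ℝ) : List ℝ × ℝ :=
  let y' := y.drop ((y.takeWhile (fun t => decide (t = 0))).length)
  squashF y'.length y'

/-- The minimum entry of a nonempty list of reals. -/
noncomputable def minL (l : List ℝ) : ℝ := l.foldr min l.headI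

/-- One step of Algorithm A: subtract the minimum `μ` from every entry and eliminate the
runs of zeros, the positive entry preceding an odd right-end run of zeros being deleted
and added to the first entry of the resulting sequence. -/
noncomputable def stepA (x : List ℝ) : List ℝ :=
  match contract (x.map (fun t => t - minL x)) with
  | ([], _) => []
  | (h :: t, c) => (h + c) :: t

/-- The data `(μ⁽ⁱ⁾, ν⁽ⁱ⁾)` produced by iterating Algorithm A while the current sequence
is nonempty (with fuel; fuel `≥` half the length always suffices). -/
noncomputable def algStepsA : ℕ → List ℝ → List (ℝ × ℕ)
  | 0, _ => []
  | _ + 1, [] => []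
  | fuel + 1, x@(_ :: _) =>
    (minL x, x.length / 2 - (stepA x).length / 2) :: algStepsA fuel (stepA x)

/-- The multiset containing, for each step `i` of the algorithm, the value
`λ⁽ⁱ⁾ = μ⁽¹⁾ + ⋯ + μ⁽ⁱ⁾` with multiplicity `ν⁽ⁱ⁾`. -/
noncomputable def diagMS : ℝ → List (ℝ × ℕ) → Multiset ℝ
  | _, [] => 0
  | acc, p :: t => Multiset.replicate p.2 (acc + p.1) + diagMS (acc + p.1) t

namespace YD

def Pth : Bool → List ℝ → Bool → ℕ → ℝ → Prop
  | b, [], e, k, s => b = e ∧ k = 0 ∧ s = 0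
  | b, x :: l, e, k, s => Pth false l e k s ∨
      (b = false ∧ ∃ k' s', k = k' + 1 ∧ s = x + s' ∧ Pth true l e k' s')

def Cyc (l : List ℝ) (k : ℕ) (s : ℝ) : Prop := ∃ b, Pth b l b k s

def NN (l : List ℝ) : Prop := ∀ t ∈ l, 0 ≤ t

theorem pth_append (l1 l2 : List ℝ) : ∀ (b e : Bool) (k : ℕ) (s : ℝ), Pth b (l1 ++ l2) e k s ↔
    ∃ c k1 k2 s1 s2, k = k1 + k2 ∧ s = s1 + s2 ∧ Pth b l1 c k1 s1 ∧ Pth c l2 e k2 s2 := by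
  induction l1 with
  | nil =>
    intro b e k s
    simp only [List.nil_append, Pth]
    constructor
    · intro h
      exact ⟨b, 0, k, 0, s, by simp, by simp, ⟨rfl, rfl, rfl⟩, h⟩
    · rintro ⟨c, k1, k2, s1, s2, rfl, rfl, ⟨rfl, rfl, rfl⟩, h⟩
      simpa using h
  | cons x l ih =>
    intro b e k s
    simp only [List.cons_append, Pth, ih]
    constructor
    · rintro (⟨c, k1, k2, s1, s2, rfl, rfl, h1, h2⟩ | ⟨rfl, k', s', rfl, rfl, c, k1, k2, s1, s2, rfl, rfl, h1, h2⟩)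
      · exact ⟨c, k1, k2, s1, s2, rfl, rfl, Or.inl h1, h2⟩
      · exact ⟨c, k1 + 1, k2, x + s1, s2, by ring, by ring, Or.inr ⟨rfl, k1, s1, rfl, rfl, h1⟩, h2⟩
    · rintro ⟨c, k1, k2, s1, s2, rfl, rfl, (h1 | ⟨rfl, k', s', rfl, rfl, h1⟩), h2⟩
      · exact Or.inl ⟨c, k1, k2, s1, s2, rfl, rfl, h1, h2⟩
      · exact Or.inr ⟨rfl, k' + k2, s' + s2, by ring, by ring, c, k', k2, s', s2, rfl, rfl, h1, h2⟩

theorem cyc_rot (l1 l2 : List ℝ) (k : ℕ) (s : ℝ) : Cyc (l1 ++ l2) k s → Cyc (l2 ++ l1) k s := by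
  rintro ⟨b, h⟩
  obtain ⟨c, k1, k2, s1, s2, rfl, rfl, h1, h2⟩ := (pth_append _ _ _ _ _ _).1 h
  exact ⟨c, (pth_append _ _ _ _ _ _).2 ⟨b, k2, k1, s2, s1, by ring, by ring, h2, h1⟩⟩

theorem pth_nonneg (l : List ℝ) (hl : NN l) : ∀ b e k s, Pth b l e k s → 0 ≤ s := by
  induction l with
  | nil => rintro b e k s ⟨_, _, rfl⟩; exact le_rfl
  | cons x l ih =>
    have hx : 0 ≤ x := hl x (by simp)
    have ih := ih (fun t ht => hl t (by simp [ht]))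
    rintro b e k s (h | ⟨_, k', s', _, rfl, h⟩)
    · exact ih _ _ _ _ h
    · linarith [ih _ _ _ _ h]

theorem pth_start (l : List ℝ) (b e k s) (h : Pth b l e k s) :
    ∃ e', (e' = e ∨ (e' = false ∧ l = [])) ∧ Pth false l e' k s := by
  cases l with
  | nil => obtain ⟨rfl, rfl, rfl⟩ := h; exact ⟨false, Or.inr ⟨rfl, rfl⟩, rfl, rfl, rfl⟩
  | cons x l =>
    rcases h with h | ⟨_, h⟩
    · exact ⟨e, Or.inl rfl, Or.inl h⟩
    · exact ⟨e, Or.inl rfl, Or.inr ⟨rfl, h⟩⟩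

theorem pth_start' (l : List ℝ) (b e k s) (h : Pth b l e k s) :
    ∃ e', (e' = e ∨ e' = false) ∧ Pth false l e' k s := by
  obtain ⟨e', h1, h2⟩ := pth_start l b e k s h
  exact ⟨e', h1.imp id (·.1), h2⟩

theorem pth_drop (l : List ℝ) (hl : NN l) : ∀ b e k s, Pth b l e (k + 1) s →
    ∃ e' s', (e' = e ∨ e' = false) ∧ s' ≤ s ∧ Pth b l e' k s' := by
  induction l with
  | nil => rintro b e k s ⟨_, h, _⟩; omega
  | cons x l ih =>
    have hx : 0 ≤ x := hl x (by simp)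
    have ih := ih (fun t ht => hl t (by simp [ht]))
    rintro b e k s (h | ⟨_, k', s', hk, rfl, h⟩)
    · obtain ⟨e', s', h1, h2, h3⟩ := ih _ _ _ _ h
      exact ⟨e', s', h1, h2, Or.inl h3⟩
    · obtain rfl : k = k' := by omega
      obtain ⟨e', h1, h2⟩ := pth_start' _ _ _ _ _ h
      exact ⟨e', s', h1, by linarith, Or.inl h2⟩

theorem pth_start_cases (l : List ℝ) (e k s) (b : Bool) (h : Pth true l e k s) (hl : l ≠ []) :
    Pth b l e k s := by
  cases l with
  | nil => exact absurd rfl hl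
  | cons x l =>
    rcases h with h | ⟨h, _⟩
    · exact Or.inl h
    · cases h

theorem cyc_drop (l : List ℝ) (hl : NN l) (k s) (h : Cyc l (k + 1) s) :
    ∃ s' ≤ s, Cyc l k s' := by
  obtain ⟨b, h⟩ := h
  obtain ⟨e', s', h1, h2, h3⟩ := pth_drop l hl _ _ _ _ h
  rcases h1 with rfl | rfl
  · exact ⟨s', h2, _, h3⟩
  · obtain ⟨e', h1, h4⟩ := pth_start' _ _ _ _ _ h3
    obtain rfl : e' = false := by simpa using h1
    exact ⟨s', h2, false, h4⟩

theorem cyc_drop_many (l : List ℝ) (hl : NN l) (k j s) (h : Cyc l (k + j) s) :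
    ∃ s' ≤ s, Cyc l k s' := by
  induction j generalizing s with
  | zero => exact ⟨s, le_rfl, h⟩
  | succ j ih =>
    obtain ⟨s1, h1, h2⟩ := cyc_drop l hl (k + j) s h
    obtain ⟨s2, h3, h4⟩ := ih s1 h2
    exact ⟨s2, h3.trans h1, h4⟩

/-- up direction of the elementary operation -/
theorem op_up (a b : ℝ) (Q : List ℝ) (k s) (h : Cyc ((a + b) :: Q) k s) :
    Cyc (a :: 0 :: b :: Q) (k + 1) s := by
  obtain ⟨c, h⟩ := h
  refine ⟨c, ?_⟩
  rcases h with h | ⟨rfl, k', s', rfl, rfl, h⟩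
  · exact Or.inl (Or.inr ⟨rfl, k, s, rfl, by ring, Or.inl h⟩)
  · exact Or.inr ⟨rfl, k' + 1, b + s', rfl, by ring, Or.inl (Or.inr ⟨rfl, k', s', rfl, rfl, h⟩)⟩

theorem op_down (a b : ℝ) (Q : List ℝ) (ha : 0 ≤ a) (hb : 0 ≤ b) (hQ : NN Q) (k s)
    (h : Cyc (a :: 0 :: b :: Q) (k + 1) s) : ∃ s' ≤ s, Cyc ((a + b) :: Q) k s' := by
  -- removal of a selection
  have key : ∀ c d k s, Pth c Q d k s → (d = false ∨ d = true) → ∃ d', Pth d' ((a + b) :: Q) d' k s := by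
    intro c d k s h _
    obtain ⟨e', _, h2⟩ := pth_start' _ _ _ _ _ h
    exact ⟨e', Or.inl h2⟩
  obtain ⟨c, h⟩ := h
  have hc : c = false ∨ c = true := by cases c <;> simp
  rcases h with h | ⟨rfl, k', s', hk, rfl, h⟩
  · rcases h with h | ⟨_, k', s', hk, rfl, h⟩
    · rcases h with h | ⟨_, k', s', hk, rfl, h⟩
      · obtain ⟨e', s', h1, h2, h3⟩ := pth_drop Q hQ _ _ _ _ h
        obtain ⟨d, hd⟩ := key _ _ _ _ h3 (by cases e' <;> simp)
        exact ⟨s', h2, d, hd⟩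
      · obtain rfl : k = k' := by omega
        obtain ⟨d, hd⟩ := key _ _ _ _ h hc
        exact ⟨s', by linarith, d, hd⟩
    · obtain rfl : k = k' := by omega
      rcases h with h | ⟨h, _⟩
      · obtain ⟨d, hd⟩ := key _ _ _ _ h hc
        exact ⟨s', by linarith, d, hd⟩
      · cases h
  · obtain rfl : k = k' := by omega
    rcases h with h | ⟨h, _⟩
    · rcases h with h | ⟨_, k', s'', rfl, rfl, h⟩
      · obtain ⟨d, hd⟩ := key _ _ _ _ h hc
        exact ⟨s', by linarith, d, hd⟩
      · exact ⟨_, le_rfl, false, Or.inr ⟨rfl, k', s'', rfl, by ring, h⟩⟩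
    · cases h

inductive Red : ℕ → List ℝ → List ℝ → Prop
  | refl (l) : Red 0 l l
  | op1 {n z} (P : List ℝ) (a b : ℝ) (Q : List ℝ) :
      Red n (P ++ (a + b) :: Q) z → Red (n + 1) (P ++ a :: 0 :: b :: Q) z
  | op2 {n z} (f a : ℝ) (Q : List ℝ) :
      Red n ((f + a) :: Q) z → Red (n + 1) (f :: Q ++ [a, 0]) z
  | op3 (a : ℝ) : Red 1 [a, 0] []

theorem Red.trans {n m : ℕ} {a b c : List ℝ} (h : Red n a b) (h' : Red m b c) :
    ∃ j, Red j a c := by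
  induction h with
  | refl l => exact ⟨_, h'⟩
  | op1 P a b Q _ ih => obtain ⟨j, hj⟩ := ih h'; exact ⟨_, .op1 P a b Q hj⟩
  | op2 f a Q _ ih => obtain ⟨j, hj⟩ := ih h'; exact ⟨_, .op2 f a Q hj⟩
  | op3 a =>
    generalize hl : ([] : List ℝ) = l at h'
    cases h' with
    | refl => subst hl; exact ⟨_, .op3 a⟩
    | op1 P a b Q => simp at hl
    | op2 f a Q => simp at hl
    | op3 => simp at hl

def hw : ℝ → List ℝ → Prop
  | _, [] => True
  | _, [_] => True
  | acc, a :: b :: t => 0 ≤ acc + a - b ∧ hw (acc + a - b) t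

theorem hw_mono : ∀ (l : List ℝ) (x y : ℝ), x ≤ y → hw x l → hw y l
  | [], _, _, _, _ => trivial
  | [_], _, _, _, _ => trivial
  | a :: b :: t, x, y, h, ⟨h1, h2⟩ =>
    ⟨by linarith, hw_mono t _ _ (by linarith) h2⟩

theorem hw_prefix : ∀ (l r : List ℝ) (x : ℝ), hw x (l ++ r) → hw x l
  | [], _, _, _ => trivial
  | [_], _, _, _ => trivial
  | _ :: _ :: t, r, _, ⟨h1, h2⟩ => ⟨h1, hw_prefix t r _ h2⟩

theorem hw_op1 : ∀ (P : List ℝ) (a b : ℝ) (Q : List ℝ) (x : ℝ),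
    hw x (P ++ a :: 0 :: b :: Q) → hw x (P ++ (a + b) :: Q)
  | [], a, b, [], x, _ => trivial
  | [], a, b, q :: Q, x, ⟨_, h1, h2⟩ =>
    ⟨by linarith, by
      have : x + (a + b) - q = x + a - 0 + b - q := by ring
      rw [this]; exact h2⟩
  | [p], a, b, Q, x, ⟨_, h1, h2⟩ =>
    ⟨by linarith, by
      have : x + p - (a + b) = x + p - a + 0 - b := by ring
      rw [this]; exact h2⟩
  | _ :: _ :: t, a, b, Q, _, ⟨h1, h2⟩ => ⟨h1, hw_op1 t a b Q _ h2⟩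

theorem hw_op2 (f a : ℝ) (Q : List ℝ) (x : ℝ) (ha : 0 ≤ a)
    (h : hw x (f :: Q ++ [a, 0])) : hw x ((f + a) :: Q) := by
  have h := hw_prefix (f :: Q) _ _ h
  cases Q with
  | nil => trivial
  | cons q Q =>
    obtain ⟨h1, h2⟩ := h
    exact ⟨by linarith, hw_mono _ _ _ (by linarith) h2⟩

theorem hw_iff : ∀ (l : List ℝ) (x : ℝ), 0 ≤ x → (hw x l ↔ ∀ k : ℕ, 2 * k ≤ l.length →
    0 ≤ x + ∑ j ∈ Finset.range k, (l.getD (2 * j) 0 - l.getD (2 * j + 1) 0))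
  | [], x, hx => by
    simp only [hw, List.length_nil, true_iff]
    intro k hk
    obtain rfl : k = 0 := by omega
    simpa using hx
  | [a], x, hx => by
    simp only [hw, List.length_singleton, true_iff]
    intro k hk
    obtain rfl : k = 0 := by omega
    simpa using hx
  | a :: b :: t, x, hx => by
    have e : ∀ k, x + ∑ j ∈ Finset.range (k + 1), ((a :: b :: t).getD (2 * j) 0 - (a :: b :: t).getD (2 * j + 1) 0)
        = (x + a - b) + ∑ j ∈ Finset.range k, (t.getD (2 * j) 0 - t.getD (2 * j + 1) 0) := by
      intro k
      rw [Finset.sum_range_succ']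
      have : ∀ j, 2 * (j + 1) = 2 * j + 1 + 1 := fun j => by ring
      simp only [this, List.getD_cons_succ]
      simp
      ring
    simp only [hw]
    constructor
    · rintro ⟨h1, h2⟩ k hk
      cases k with
      | zero => simpa using hx
      | succ k =>
        rw [e]
        exact (hw_iff t _ h1).1 h2 k (by simp at hk; omega)
    · intro h
      have h1 : 0 ≤ x + a - b := by
        have := h 1 (by simp)
        rw [e 0] at this
        simpa using this
      refine ⟨h1, (hw_iff t _ h1).2 fun k hk => ?_⟩
      rw [← e]
      exact h (k + 1) (by simp; omega)

theorem HWC_iff (l : List ℝ) : HWC l ↔ hw 0 l := by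
  rw [hw_iff l 0 le_rfl]; simp [HWC]

theorem red_len {n l l'} (h : Red n l l') : l.length = l'.length + 2 * n := by
  induction h with
  | refl => simp
  | op1 P a b Q _ ih => simp at ih ⊢; omega
  | op2 f a Q _ ih => simp at ih ⊢; omega
  | op3 => simp

theorem red_nn {n l l'} (h : Red n l l') (hl : NN l) : NN l' := by
  induction h with
  | refl => exact hl
  | op1 P a b Q _ ih =>
    apply ih
    intro t ht
    simp only [NN, List.mem_append, List.mem_cons] at hl ht
    rcases ht with ht | rfl | ht
    · exact hl t (by simp [ht])
    · exact add_nonneg (hl a (by simp)) (hl b (by simp))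
    · exact hl t (by simp [ht])
  | op2 f a Q _ ih =>
    apply ih
    intro t ht
    simp only [NN, List.mem_append, List.mem_cons] at hl ht
    rcases ht with rfl | ht
    · exact add_nonneg (hl f (by simp)) (hl a (by simp))
    · exact hl t (by simp [ht])
  | op3 => intro t ht; simp at ht

theorem op1_nn {P : List ℝ} {a b : ℝ} {Q : List ℝ} (hl : NN (P ++ a :: 0 :: b :: Q)) :
    NN (P ++ (a + b) :: Q) := red_nn (.op1 P a b Q (.refl _)) hl

theorem op2_nn {f a : ℝ} {Q : List ℝ} (hl : NN (f :: Q ++ [a, 0])) :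
    NN ((f + a) :: Q) := red_nn (.op2 f a Q (.refl _)) hl

theorem red_hw {n l l'} (h : Red n l l') (hl : NN l) (hh : hw 0 l) : hw 0 l' := by
  induction h with
  | refl => exact hh
  | op1 P a b Q _ ih => exact ih (op1_nn hl) (hw_op1 P a b Q _ hh)
  | op2 f a Q _ ih => exact ih (op2_nn hl) (hw_op2 f a Q _ (hl a (by simp)) hh)
  | op3 => trivial

theorem red_up {n l l'} (h : Red n l l') (k s) (hc : Cyc l' k s) : Cyc l (k + n) s := by
  induction h with
  | refl => exact hc
  | op1 P a b Q _ ih =>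
    have h1 := cyc_rot _ _ _ _ (ih hc)
    have h2 := op_up a b (Q ++ P) _ _ (by simpa using h1)
    exact cyc_rot (a :: 0 :: b :: Q) P _ _ (by simpa [add_assoc] using h2)
  | op2 f a Q _ ih =>
    have h1 := ih hc
    rw [add_comm f a] at h1
    have h2 := op_up a f Q _ _ h1
    exact cyc_rot [a, 0] (f :: Q) _ _ (by simpa [add_assoc] using h2)
  | op3 a =>
    obtain ⟨b, _, rfl, rfl⟩ := hc
    exact ⟨true, Or.inl (Or.inr ⟨rfl, 0, 0, rfl, by simp, rfl, rfl, rfl⟩)⟩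

theorem red_down {n l l'} (h : Red n l l') (hl : NN l) (k s) (hc : Cyc l (k + n) s) :
    ∃ s' ≤ s, Cyc l' k s' := by
  induction h generalizing s with
  | refl => exact ⟨s, le_rfl, hc⟩
  | @op1 n z P a b Q _ ih =>
    have h1 := cyc_rot _ _ _ _ hc
    have hQ : NN (Q ++ P) := fun t ht => hl t (by simp at ht ⊢; tauto)
    obtain ⟨s1, h2, h3⟩ := op_down a b (Q ++ P) (hl a (by simp)) (hl b (by simp)) hQ (k + n) s
      (by simpa [add_assoc] using h1)
    have h4 := cyc_rot ((a + b) :: Q) P _ _ (by simpa using h3)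
    obtain ⟨s2, h5, h6⟩ := ih (op1_nn hl) _ h4
    exact ⟨s2, h5.trans h2, h6⟩
  | @op2 n z f a Q _ ih =>
    have h1 := cyc_rot _ _ _ _ hc
    have hQ : NN Q := fun t ht => hl t (by simp at ht ⊢; tauto)
    obtain ⟨s1, h2, h3⟩ := op_down a f Q (hl a (by simp)) (hl f (by simp)) hQ (k + n) s
      (by simpa [add_assoc] using h1)
    rw [add_comm a f] at h3
    obtain ⟨s2, h5, h6⟩ := ih (op2_nn hl) _ h3
    exact ⟨s2, h5.trans h2, h6⟩
  | op3 a =>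
    obtain ⟨b, hb⟩ := hc
    have h0 := pth_nonneg _ hl _ _ _ _ hb
    have : k = 0 := by
      simp only [Pth] at hb
      rcases hb with (⟨_, h, _⟩ | ⟨_, k', _, h, _, _, h', _⟩) | ⟨_, k', _, h, _, h' | h'⟩
      · omega
      · omega
      · omega
      · simp at h'
    subst this
    exact ⟨0, h0, false, rfl, rfl, rfl⟩

def fin (l : List ℝ) (c : ℝ) : List ℝ :=
  match l with
  | [] => []
  | h :: t => (h + c) :: t

theorem red_zeros (P : List ℝ) (a : ℝ) (j : ℕ) (r : List ℝ) :
    ∃ n, Red n (P ++ a :: (List.replicate (2 * j) 0 ++ r)) (P ++ a :: r) := by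
  induction j with
  | zero => exact ⟨0, by simpa using Red.refl _⟩
  | succ j ih =>
    obtain ⟨n, hn⟩ := ih
    refine ⟨n + 1, ?_⟩
    have := Red.op1 (n := n) (z := P ++ a :: r) P a 0 (List.replicate (2 * j) 0 ++ r) (by simpa using hn)
    simpa [mul_add, List.replicate_succ] using this

theorem takeWhile_zero (l : List ℝ) : ∃ m r, l = List.replicate m 0 ++ r ∧
    (l.takeWhile (fun t => decide (t = 0))).length = m ∧ l.drop m = r ∧
    (∀ h t, r = h :: t → h ≠ 0) := by
  induction l with
  | nil => exact ⟨0, [], by simp⟩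
  | cons x l ih =>
    by_cases hx : x = 0
    · obtain ⟨m, r, h1, h2, h3, h4⟩ := ih
      refine ⟨m + 1, r, ?_, ?_, ?_, h4⟩
      · simp [List.replicate_succ, hx, ← h1]
      · simp [hx, h2]
      · simpa using h3
    · refine ⟨0, x :: l, by simp, by simp [hx], by simp, ?_⟩
      rintro h t ⟨⟩
      exact hx

theorem squash_red : ∀ (fuel : ℕ) (w : List ℝ), w ≠ [] → w.length ≤ fuel → ∀ P : List ℝ,
    ∃ n, Red n (P ++ w) (fin (P ++ (squashF fuel w).1) (squashF fuel w).2) := by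
  intro fuel
  induction fuel with
  | zero =>
    intro w hw hl
    exact absurd (List.length_eq_zero_iff.1 (by omega)) hw
  | succ fuel ih =>
    intro w hw hl P
    cases w with
    | nil => exact absurd rfl hw
    | cons a rest =>
      obtain ⟨m, r, h1, h2, h3, h4⟩ := takeWhile_zero rest
      simp only [squashF, h2, h3]
      have fin0 : ∀ l, fin l 0 = l := by intro l; cases l <;> simp [fin]
      have hlen : rest.length = m + r.length := by rw [h1]; simp
      by_cases hr : r = []
      · subst hr
        rcases Nat.even_or_odd' m with ⟨j, rfl | rfl⟩
        · obtain ⟨n, hn⟩ := red_zeros P a j []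
          refine ⟨n, ?_⟩
          simpa [fin0, h1] using hn
        · obtain ⟨n, hn⟩ := red_zeros P a j [0]
          have hodd : ¬ Even (2 * j + 1) := by simp
          simp only [if_neg hodd, if_true, List.append_nil]
          have e : P ++ a :: rest = P ++ a :: (List.replicate (2 * j) 0 ++ [0]) := by
            rw [h1]; simp [List.replicate_succ']
          rw [e]
          cases P with
          | nil => exact hn.trans (.op3 a)
          | cons f P => exact hn.trans (.op2 f a P (.refl _))
      · obtain ⟨b, r, rfl⟩ := List.exists_cons_of_ne_nil hr
        simp only [if_neg hr, List.headI, List.tail]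
        simp at hl hlen
        rcases Nat.even_or_odd' m with ⟨j, rfl | rfl⟩
        · obtain ⟨n, hn⟩ := red_zeros P a j (b :: r)
          obtain ⟨n', hn'⟩ := ih (b :: r) (by simp) (by simp; omega) (P ++ [a])
          rw [← h1] at hn
          have he : Even (2 * j) := by simp
          simp only [if_pos he]
          exact hn.trans (by simpa using hn')
        · obtain ⟨n, hn⟩ := red_zeros P a j (0 :: b :: r)
          obtain ⟨n', hn'⟩ := ih ((a + b) :: r) (by simp) (by simp; omega) P
          have e : P ++ a :: rest = P ++ a :: (List.replicate (2 * j) 0 ++ 0 :: b :: r) := by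
            rw [h1]; simp [List.replicate_succ']
          have hodd : ¬ Even (2 * j + 1) := by simp
          simp only [if_neg hodd]
          rw [e]
          exact hn.trans (.op1 P a b r hn')

theorem squash_pos : ∀ (fuel : ℕ) (a : ℝ) (w : List ℝ), 0 < a → NN w →
    (∀ t ∈ (squashF fuel (a :: w)).1, 0 < t) ∧ 0 ≤ (squashF fuel (a :: w)).2 := by
  intro fuel
  induction fuel with
  | zero => intro a w _ _; simp [squashF]
  | succ fuel ih =>
    intro a rest ha hn
    obtain ⟨m, r, h1, h2, h3, h4⟩ := takeWhile_zero rest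
    simp only [squashF, h2, h3]
    by_cases hr : r = []
    · by_cases hm : Even m <;> simp [hr, hm, ha, ha.le]
    · obtain ⟨b, r, rfl⟩ := List.exists_cons_of_ne_nil hr
      have hb : 0 < b := lt_of_le_of_ne (hn b (by simp [h1])) (Ne.symm (h4 b r rfl))
      have hr' : NN r := fun t ht => hn t (by simp [h1, ht])
      simp only [if_neg hr, List.headI, List.tail]
      by_cases hm : Even m
      · simp only [if_pos hm]
        have := ih b r hb hr'
        refine ⟨?_, this.2⟩
        intro t ht
        rcases List.mem_cons.1 ht with rfl | ht
        · exact ha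
        · exact this.1 t ht
      · simp only [if_neg hm]
        exact ih (a + b) r (by linarith) hr'

theorem left_red : ∀ (y : List ℝ), NN y → hw 0 y → Even y.length →
    ∃ n, Red n y (y.drop ((y.takeWhile (fun t => decide (t = 0))).length))
  | [], _, _, _ => ⟨0, .refl _⟩
  | [_], _, _, h => by simp at h
  | a :: b :: t, hn, hh, he => by
    by_cases ha : a = 0
    · subst ha
      obtain ⟨h1, h2⟩ := hh
      have hb : b = 0 := le_antisymm (by linarith) (hn b (by simp))
      subst hb
      obtain ⟨n, hr⟩ := left_red t (fun s hs => hn s (by simp [hs])) (by simpa using h2)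
        (by simpa [Nat.even_add_one] using he)
      have hs : ∃ n, Red n (0 :: 0 :: t) t := by
        cases t with
        | nil => exact ⟨_, .op3 0⟩
        | cons f t => exact ⟨_, .op1 [] 0 f t (by simpa using Red.refl _)⟩
      obtain ⟨n', hs⟩ := hs
      obtain ⟨j, hj⟩ := hs.trans hr
      exact ⟨j, by simpa using hj⟩
    · exact ⟨0, by simpa [ha] using Red.refl _⟩

theorem minL_aux : ∀ (l : List ℝ) (d : ℝ), (l.foldr min d = d ∨ l.foldr min d ∈ l) ∧
    (∀ t ∈ l, l.foldr min d ≤ t) ∧ l.foldr min d ≤ d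
  | [], d => by simp
  | a :: l, d => by
    obtain ⟨h1, h2, h3⟩ := minL_aux l d
    simp only [List.foldr_cons]
    refine ⟨?_, ?_, ?_⟩
    · rcases min_choice a (l.foldr min d) with h | h
      · right; simp [h]
      · rw [h]; rcases h1 with h1 | h1
        · left; exact h1
        · right; simp [h1]
    · intro t ht
      rcases List.mem_cons.1 ht with rfl | ht
      · exact min_le_left _ _
      · exact (min_le_right _ _).trans (h2 t ht)
    · exact (min_le_right _ _).trans h3

theorem minL_mem (l : List ℝ) (h : l ≠ []) : minL l ∈ l := by
  obtain ⟨a, l, rfl⟩ := List.exists_cons_of_ne_nil h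
  rcases (minL_aux (a :: l) a).1 with h | h
  · simp only [minL, List.headI]; rw [h]; simp
  · exact h

theorem minL_le (l : List ℝ) (t) (ht : t ∈ l) : minL l ≤ t := (minL_aux l _).2.1 t ht

theorem hw_map (μ : ℝ) : ∀ (l : List ℝ) (x : ℝ), hw x l → hw x (l.map (fun t => t - μ))
  | [], _, _ => trivial
  | [_], _, _ => trivial
  | a :: b :: t, x, ⟨h1, h2⟩ => by
    have e : x + (a - μ) - (b - μ) = x + a - b := by ring
    exact ⟨by linarith, by rw [e]; exact hw_map μ t _ h2⟩

theorem stepA_eq (x : List ℝ) : stepA x = fin (contract (x.map (fun t => t - minL x))).1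
    (contract (x.map (fun t => t - minL x))).2 := by
  unfold stepA fin
  rcases contract (x.map (fun t => t - minL x)) with ⟨_ | ⟨h, t⟩, c⟩ <;> rfl

theorem step_red (x : List ℝ) (hx : x ≠ []) (hh : hw 0 x) (he : Even x.length) :
    ∃ n, 0 < n ∧ Red n (x.map (fun t => t - minL x)) (stepA x) := by
  rw [stepA_eq]
  set y := x.map (fun t => t - minL x) with hy
  have hyn : NN y := by
    intro t ht
    obtain ⟨s, hs, rfl⟩ := List.mem_map.1 ht
    linarith [minL_le x s hs]
  have h0 : (0 : ℝ) ∈ y := List.mem_map.2 ⟨minL x, minL_mem x hx, by simp⟩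
  have hyh : hw 0 y := hw_map _ _ _ hh
  obtain ⟨n, hn⟩ := left_red y hyn hyh (by simpa [hy] using he)
  obtain ⟨m, r, h1, h2, h3, h4⟩ := takeWhile_zero y
  simp only [contract]
  rw [h2, h3] at hn ⊢
  have hrn := red_nn hn hyn
  have : ∃ n, Red n y (fin (squashF r.length r).1 (squashF r.length r).2) ∧
      ∀ t ∈ fin (squashF r.length r).1 (squashF r.length r).2, 0 < t := by
    cases r with
    | nil => exact ⟨n, by simpa [squashF, fin] using hn, by simp [squashF, fin]⟩
    | cons a r =>
      obtain ⟨n', hn'⟩ := squash_red (a :: r).length (a :: r) (by simp) le_rfl []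
      obtain ⟨j, hj⟩ := hn.trans hn'
      refine ⟨j, by simpa using hj, ?_⟩
      have ha : 0 < a := lt_of_le_of_ne (hrn a (by simp)) (Ne.symm (h4 a r rfl))
      obtain ⟨p1, p2⟩ := squash_pos (a :: r).length a r ha (fun t ht => hrn t (by simp [ht]))
      intro t ht
      rcases h : (squashF (a :: r).length (a :: r)).1 with _ | ⟨u, v⟩
      · rw [h] at ht; simp [fin] at ht
      · rw [h] at ht p1
        simp only [fin, List.mem_cons] at ht
        rcases ht with rfl | ht
        · have := p1 u (by simp); linarith
        · exact p1 t (by simp [ht])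
  obtain ⟨j, hj, hp⟩ := this
  refine ⟨j, ?_, hj⟩
  rcases Nat.eq_zero_or_pos j with rfl | h
  · exfalso
    generalize hz : fin (squashF r.length r).1 (squashF r.length r).2 = z at hj hp
    cases hj
    exact lt_irrefl _ (hp 0 h0)
  · exact h

theorem pth_map (μ : ℝ) (l : List ℝ) : ∀ b e k s,
    Pth b (l.map (fun t => t - μ)) e k s ↔ Pth b l e k (s + k * μ) := by
  induction l with
  | nil =>
    intro b e k s
    simp only [List.map_nil, Pth]
    constructor
    · rintro ⟨rfl, rfl, rfl⟩; simp
    · rintro ⟨rfl, rfl, h⟩; simpa using h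
  | cons x l ih =>
    intro b e k s
    simp only [List.map_cons, Pth, ih]
    refine or_congr Iff.rfl (and_congr Iff.rfl ?_)
    constructor
    · rintro ⟨k', s', rfl, rfl, h⟩
      exact ⟨k', _, rfl, by push_cast; ring, h⟩
    · rintro ⟨k', s', rfl, h1, h⟩
      refine ⟨k', s' - k' * μ, rfl, ?_, by simpa using h⟩
      push_cast at h1; linarith

def IsMin (l : List ℝ) (k : ℕ) (v : ℝ) : Prop :=
  (∃ s ≤ v, Cyc l k s) ∧ ∀ s, Cyc l k s → v ≤ s

theorem isMin_map (μ : ℝ) (l : List ℝ) (k v) (h : IsMin (l.map (fun t => t - μ)) k v) :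
    IsMin l k (v + k * μ) := by
  obtain ⟨⟨s, h1, b, h2⟩, h3⟩ := h
  refine ⟨⟨s + k * μ, by linarith, b, (pth_map _ _ _ _ _ _).1 h2⟩, ?_⟩
  rintro s ⟨b, hb⟩
  have := h3 (s - k * μ) ⟨b, (pth_map _ _ _ _ _ _).2 (by simpa using hb)⟩
  linarith

theorem cyc_zero (l : List ℝ) : Cyc l 0 0 := by
  refine ⟨false, ?_⟩
  induction l with
  | nil => exact ⟨rfl, rfl, rfl⟩
  | cons x l ih => exact Or.inl ih

noncomputable def diagL : ℝ → List (ℝ × ℕ) → List ℝ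
  | _, [] => []
  | acc, p :: t => List.replicate p.2 (acc + p.1) ++ diagL (acc + p.1) t

theorem diag_coe : ∀ (t : List (ℝ × ℕ)) (acc : ℝ), diagMS acc t = (diagL acc t : Multiset ℝ)
  | [], _ => rfl
  | p :: t, acc => by
    simp only [diagMS, diagL, diag_coe t, ← Multiset.coe_add, Multiset.coe_replicate]

theorem diagL_ge : ∀ (t : List (ℝ × ℕ)) (acc : ℝ), (∀ p ∈ t, 0 ≤ p.1) → ∀ s ∈ diagL acc t, acc ≤ s
  | [], _, _, s, hs => by simp [diagL] at hs
  | p :: t, acc, h, s, hs => by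
    have hp := h p (by simp)
    simp only [diagL, List.mem_append] at hs
    rcases hs with hs | hs
    · rw [List.eq_of_mem_replicate hs]; linarith
    · have := diagL_ge t _ (fun q hq => h q (by simp [hq])) s hs
      linarith

theorem diagL_sorted : ∀ (t : List (ℝ × ℕ)) (acc : ℝ), (∀ p ∈ t, 0 ≤ p.1) →
    (diagL acc t).Pairwise (· ≤ ·)
  | [], _, _ => List.Pairwise.nil
  | p :: t, acc, h => by
    have ht : ∀ q ∈ t, 0 ≤ q.1 := fun q hq => h q (by simp [hq])
    simp only [diagL]
    rw [List.pairwise_append]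
    refine ⟨?_, diagL_sorted t _ ht, ?_⟩
    · rw [List.pairwise_replicate]; right; exact le_rfl
    · intro a ha b hb
      rw [List.eq_of_mem_replicate ha]
      exact diagL_ge t _ ht b hb

theorem main_ind : ∀ (fuel : ℕ) (x : List ℝ), x.length ≤ fuel → NN x → hw 0 x → Even x.length →
    (∀ p ∈ algStepsA fuel x, 0 ≤ p.1) ∧
    ∀ k, 2 * k ≤ x.length → ∀ acc : ℝ,
      ∃ v, IsMin x k v ∧ ((diagL acc (algStepsA fuel x)).take k).sum = k * acc + v := by
  have nil_case : ∀ k, 2 * k ≤ ([] : List ℝ).length → ∀ acc : ℝ,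
      ∃ v, IsMin [] k v ∧ ((diagL acc []).take k).sum = k * acc + v := by
    intro k hk acc
    obtain rfl : k = 0 := by simpa using hk
    refine ⟨0, ⟨⟨0, le_rfl, cyc_zero _⟩, ?_⟩, by simp⟩
    rintro s ⟨b, _, _, rfl⟩; exact le_rfl
  intro fuel
  induction fuel with
  | zero =>
    intro x hl _ _ _
    obtain rfl : x = [] := List.length_eq_zero_iff.1 (by omega)
    exact ⟨by simp [algStepsA], by simpa only [algStepsA] using nil_case⟩
  | succ fuel ih =>
    intro x hl hn hh he
    rcases x with _ | ⟨a, w⟩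
    · exact ⟨by simp [algStepsA], by simpa only [algStepsA] using nil_case⟩
    · simp only [algStepsA]
      generalize hx : a :: w = x at *
      have hne : x ≠ [] := by rw [← hx]; simp
      obtain ⟨n, hn0, hr⟩ := step_red x hne hh he
      set μ := minL x with hμ
      have hμ0 : 0 ≤ μ := hn _ (minL_mem x hne)
      have hyn : NN (x.map (fun t => t - μ)) := by
        intro t ht
        obtain ⟨s, hs, rfl⟩ := List.mem_map.1 ht
        linarith [minL_le x s hs]
      have hlen := red_len hr
      rw [List.length_map] at hlen
      have hν : x.length / 2 - (stepA x).length / 2 = n := by omega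
      rw [hν]
      obtain ⟨i1, i2⟩ := ih (stepA x) (by omega) (red_nn hr hyn)
        (red_hw hr hyn (hw_map _ _ _ hh)) (by rw [hlen] at he; simpa [Nat.even_add] using he)
      refine ⟨?_, ?_⟩
      · intro p hp
        rcases List.mem_cons.1 hp with rfl | hp
        · exact hμ0
        · exact i1 p hp
      · intro k hk acc
        simp only [diagL]
        rcases le_total k n with hkn | hkn
        · refine ⟨0 + k * μ, isMin_map μ x k 0 ⟨?_, ?_⟩, ?_⟩
          · have := red_up hr 0 0 (cyc_zero _)
            obtain ⟨j, rfl⟩ := Nat.exists_eq_add_of_le hkn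
            rw [Nat.zero_add] at this
            exact cyc_drop_many _ hyn _ _ _ this
          · rintro s ⟨b, hb⟩
            exact pth_nonneg _ hyn _ _ _ _ hb
          · rw [List.take_append_of_le_length (by simpa using hkn)]
            simp [List.take_replicate, hkn]
        · obtain ⟨j, rfl⟩ := Nat.exists_eq_add_of_le hkn
          obtain ⟨v, ⟨⟨s, hs, hc⟩, hv⟩, hsum⟩ := i2 j (by omega) (acc + μ)
          refine ⟨v + (n + j : ℕ) * μ, isMin_map μ x _ v ⟨⟨s, hs, ?_⟩, ?_⟩, ?_⟩
          · have := red_up hr _ _ hc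
            rwa [add_comm] at this
          · intro s hs
            rw [add_comm] at hs
            obtain ⟨s', h1, h2⟩ := red_down hr hyn _ _ hs
            exact (hv _ h2).trans h1
          · rw [List.take_append]
            simp [List.take_replicate, hsum]; ring

theorem pth_fun (l : List ℝ) : ∀ b e k s, Pth b l e k s ↔ ∃ f : ℕ → Bool, f 0 = b ∧
    f l.length = e ∧ (∀ i < l.length, ¬ (f i = true ∧ f (i + 1) = true)) ∧
    k = ∑ i ∈ Finset.range l.length, (if f (i + 1) = true then 1 else 0) ∧
    s = ∑ i ∈ Finset.range l.length, (if f (i + 1) = true then l.getD i 0 else 0) := by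
  induction l with
  | nil =>
    intro b e k s
    simp only [Pth]
    constructor
    · rintro ⟨rfl, rfl, rfl⟩; exact ⟨fun _ => b, by simp⟩
    · rintro ⟨f, rfl, rfl, _, rfl, rfl⟩; simp
  | cons x l ih =>
    intro b e k s
    simp only [Pth, ih, List.length_cons, Finset.sum_range_succ', List.getD_cons_succ]
    constructor
    · rintro (⟨f, h0, h1, h2, rfl, rfl⟩ | ⟨rfl, k', s', rfl, rfl, f, h0, h1, h2, rfl, rfl⟩)
      · refine ⟨fun i => Nat.casesOn i b f, rfl, h1, ?_, by simp [h0], by simp [h0]⟩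
        rintro (_ | i) hi
        · simp [h0]
        · exact h2 i (by omega)
      · refine ⟨fun i => Nat.casesOn i false f, rfl, h1, ?_, by simp [h0], by simp [h0, add_comm]⟩
        rintro (_ | i) hi
        · simp
        · exact h2 i (by omega)
    · rintro ⟨f, rfl, rfl, h2, rfl, rfl⟩
      cases h : f 1 with
      | false =>
        left
        exact ⟨fun i => f (i + 1), h, rfl, fun i hi => h2 (i + 1) (by omega), by simp [h], by simp [h]⟩
      | true =>
        right
        refine ⟨by simpa [h] using h2 0 (by omega), _, _, by simp [h], by simp [h, add_comm],
          fun i => f (i + 1), h, rfl, fun i hi => h2 (i + 1) (by omega), rfl, rfl⟩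

theorem cyc_iff (N : ℕ) (hN : 1 ≤ N) (x : List ℝ) (hlen : x.length = 2 * N) (k s) :
    Cyc x k s ↔ ∃ S : Finset ℕ, CycSparse N S ∧ S.card = k ∧ s = ∑ i ∈ S, x.getD (i - 1) 0 := by
  simp only [Cyc, pth_fun, hlen]
  constructor
  · rintro ⟨b, f, h0, h1, h2, rfl, rfl⟩
    refine ⟨((Finset.range (2 * N)).filter (fun i => f (i + 1) = true)).map ⟨Nat.succ, Nat.succ_injective⟩, ⟨?_, ?_, ?_⟩, ?_, ?_⟩
    · intro i hi
      simp at hi ⊢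
      obtain ⟨a, ha, rfl⟩ := hi
      omega
    · intro i hi j hj hij
      simp at hi hj
      obtain ⟨a, ha, rfl⟩ := hi
      obtain ⟨c, hc, rfl⟩ := hj
      by_contra hcon
      obtain rfl : c = a + 1 := by omega
      exact h2 (a + 1) (by omega) ⟨ha.2, hc.2⟩
    · rintro ⟨hi, hj⟩
      simp at hi hj
      obtain ⟨a, ha, ha'⟩ := hj
      rw [ha'] at ha
      exact h2 0 (by omega) ⟨by rw [h0, ← h1]; exact ha.2, hi.2⟩
    · simp
    · simp [Finset.sum_filter]
  · rintro ⟨S, ⟨hS, hsp, hcy⟩, rfl, rfl⟩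
    have h0S : 0 ∉ S := fun h => by have := hS h; simp at this
    have hS' : S = ((Finset.range (2 * N)).filter (fun i => i + 1 ∈ S)).map ⟨Nat.succ, Nat.succ_injective⟩ := by
      ext i
      simp
      constructor
      · intro hi
        have := hS hi
        simp at this
        refine ⟨i - 1, ⟨by omega, ?_⟩, by omega⟩
        rwa [Nat.sub_add_cancel this.1]
      · rintro ⟨a, ha, rfl⟩
        exact ha.2
    refine ⟨decide (2 * N ∈ S), fun i => decide (i ∈ S ∨ (i = 0 ∧ 2 * N ∈ S)), ?_, ?_, ?_, ?_, ?_⟩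
    · simp [h0S]
    · have : N ≠ 0 := by omega
      simp [this]
    · intro i hi
      simp only [decide_eq_true_eq]
      rintro ⟨h1 | ⟨rfl, h1⟩, h2 | ⟨h2, _⟩⟩
      · have := hsp i h1 (i + 1) h2 (by omega); omega
      · omega
      · exact hcy ⟨h2, h1⟩
      · omega
    · conv_lhs => rw [hS']
      simp
    · conv_lhs => rw [hS']
      simp [Finset.sum_filter]

end YD

/-- Main theorem: for a positive highest weight state `x` (1-indexed entries
`x_i = x.getD (i-1) 0`) of the tropical periodic Toda lattice, the sum of the `k`
smallest elements (with multiplicity) of the multiset produced by Algorithm A equals the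
`k`-th conserved quantity
`H_k(x) = min { ∑_{i ∈ S} x_i : S ⊆ {1,…,2N} cyclically sparse, |S| = k }`. -/
theorem young_diagrams_coincide (N : ℕ) (hN : 1 ≤ N) (x : List ℝ)
    (hlen : x.length = 2 * N) (hpos : ∀ t ∈ x, 0 < t) (hhwc : HWC x)
    (hphase : ∑ l ∈ Finset.range N, x.getD (2 * l + 1) 0
      < ∑ l ∈ Finset.range N, x.getD (2 * l) 0) :
    ∀ k, 1 ≤ k → k ≤ N →
      (((diagMS 0 (algStepsA x.length x)).sort (· ≤ ·)).take k).sum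
        = sInf {s : ℝ | ∃ S : Finset ℕ,
            CycSparse N S ∧ S.card = k ∧ s = ∑ i ∈ S, x.getD (i - 1) 0} := by
  intro k _ hkN
  have hn : YD.NN x := fun t ht => (hpos t ht).le
  obtain ⟨h1, h2⟩ := YD.main_ind x.length x le_rfl hn ((YD.HWC_iff x).1 hhwc) (by simp [hlen])
  obtain ⟨v, ⟨⟨s, hs, hc⟩, hv⟩, hsum⟩ := h2 k (by omega) 0
  have hsort : (diagMS 0 (algStepsA x.length x)).sort (· ≤ ·) = YD.diagL 0 (algStepsA x.length x) := by
    rw [YD.diag_coe]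
    exact List.Perm.eq_of_pairwise' (Multiset.pairwise_sort _ _) (YD.diagL_sorted _ _ h1)
      (Multiset.coe_eq_coe.1 (Multiset.sort_eq _ _))
  rw [hsort, hsum]
  have hsv : s = v := le_antisymm hs (hv s hc)
  subst hsv
  have hl : IsLeast {t : ℝ | ∃ S : Finset ℕ,
            CycSparse N S ∧ S.card = k ∧ t = ∑ i ∈ S, x.getD (i - 1) 0} s :=
    ⟨(YD.cyc_iff N hN x hlen k s).1 hc, fun t ht => hv t ((YD.cyc_iff N hN x hlen k t).2 ht)⟩
  rw [hl.csInf_eq]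
  simp
end

section
/- Let N ≥ 2, let A = (A_n)_{n∈ℤ/2Nℤ} be positive reals with Σ_{l=1}^{N} A_{2l} < Σ_{l=1}^{N} A_{2l−1}, and let Ā be the image of A under the tropical periodic Toda lattice evolution. Let A' be any even cyclic shift of A satisfying the highest weight condition and let Ā' be any even cyclic shift of Ā satisfying the highest weight condition (such shifts exist). Then the multiset of N positive reals produced by Algorithm A from A' (containing λ^{(i)} with multiplicity ν^{(i)}) coincides with the multiset produced by Algorithm A from Ā'. In particular, the Young diagram defined by the generalized Kerov–Kirillov–Reshetikhin algorithm is preserved under the time evolution of the tropical periodic Toda lattice. -/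
/-- The even cyclic shift `(A_{2m+1}, A_{2m+2}, …, A_{2N}, A_1, …, A_{2m})` of a state
`A : ℤ/2Nℤ → ℝ`, written as a list. -/
noncomputable def shiftList (N : ℕ) (A : ZMod (2 * N) → ℝ) (m : ℕ) : List ℝ :=
  List.ofFn (fun j : Fin (2 * N) => A ((2 * m + 1 + (j : ℕ) : ℕ) : ZMod (2 * N)))

/-- The multiset of parts of the Young diagram produced by Algorithm A from a list. -/
noncomputable def youngMS (x : List ℝ) : Multiset ℝ :=
  diagMS 0 (algStepsA x.length x)

/-! ### Independent selections on cyclic lists -/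

inductive Sel : List ℝ → Bool → Bool → ℕ → ℝ → Prop
  | nil (b : Bool) : Sel [] b b 0 0
  | skip {l : List ℝ} {b e : Bool} {k : ℕ} {s : ℝ} (x : ℝ) :
      Sel l false e k s → Sel (x :: l) b e k s
  | take {l : List ℝ} {e : Bool} {k : ℕ} {s : ℝ} (x : ℝ) :
      Sel l true e k s → Sel (x :: l) false e (k + 1) (x + s)

def UC (l : List ℝ) (k : ℕ) (s : ℝ) : Prop := ∃ f s', Sel l f f k s' ∧ s' ≤ s

def NN (l : List ℝ) : Prop := ∀ t ∈ l, 0 ≤ t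

theorem NN.cons {a : ℝ} {l : List ℝ} (h : NN (a :: l)) : 0 ≤ a ∧ NN l := by
  simpa [NN] using h

theorem NN.mk {a : ℝ} {l : List ℝ} (h : 0 ≤ a) (h2 : NN l) : NN (a :: l) := by
  simp only [NN, List.mem_cons, forall_eq_or_imp] at *; exact ⟨h, h2⟩

theorem NN.app {l m : List ℝ} (h : NN (l ++ m)) : NN l ∧ NN m :=
  ⟨fun t ht => h t (by simp [ht]), fun t ht => h t (by simp [ht])⟩

theorem NN.append {l m : List ℝ} (h : NN l) (h' : NN m) : NN (l ++ m) := by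
  intro t ht
  rcases List.mem_append.1 ht with h1 | h1
  · exact h t h1
  · exact h' t h1

theorem Sel.append {l m : List ℝ} {b e f : Bool} {k j : ℕ} {s t : ℝ}
    (h : Sel l b e k s) (h' : Sel m e f j t) : Sel (l ++ m) b f (k + j) (s + t) := by
  induction h with
  | nil b => simpa using h'
  | skip x _ ih => exact Sel.skip x (ih h')
  | take x _ ih =>
    have := Sel.take x (ih h')
    rw [← add_assoc, Nat.add_right_comm] at this
    exact this

theorem Sel.split {l m : List ℝ} {b f : Bool} {k : ℕ} {s : ℝ} (h : Sel (l ++ m) b f k s) :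
    ∃ e k1 k2 s1 s2, Sel l b e k1 s1 ∧ Sel m e f k2 s2 ∧ k = k1 + k2 ∧ s = s1 + s2 := by
  induction l generalizing b k s with
  | nil => exact ⟨b, 0, k, 0, s, Sel.nil b, h, by simp, by simp⟩
  | cons x l ih =>
    cases h with
    | skip _ h =>
      obtain ⟨e, k1, k2, s1, s2, h1, h2, h3, h4⟩ := ih h
      exact ⟨e, k1, k2, s1, s2, Sel.skip x h1, h2, h3, h4⟩
    | take _ h =>
      obtain ⟨e, k1, k2, s1, s2, h1, h2, h3, h4⟩ := ih h
      exact ⟨e, k1 + 1, k2, x + s1, s2, Sel.take x h1, h2, by omega, by rw [h4]; ring⟩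

theorem UC.rot1 {l m : List ℝ} {k : ℕ} {s : ℝ} (h : UC (l ++ m) k s) : UC (m ++ l) k s := by
  obtain ⟨f, s', h, hs⟩ := h
  obtain ⟨e, k1, k2, s1, s2, h1, h2, h3, h4⟩ := h.split
  refine ⟨e, s', ?_, hs⟩
  have := h2.append h1
  rw [h3, h4, add_comm k1, add_comm s1]; exact this

theorem UC.rot (l m : List ℝ) (k : ℕ) (s : ℝ) : UC (l ++ m) k s ↔ UC (m ++ l) k s :=
  ⟨UC.rot1, UC.rot1⟩

theorem Sel.shift {l : List ℝ} {b e : Bool} {k : ℕ} {s : ℝ} (c : ℝ) (h : Sel l b e k s) :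
    Sel (l.map (fun t => t - c)) b e k (s - k * c) := by
  induction h with
  | nil b => simpa using Sel.nil b
  | skip x _ ih => exact Sel.skip _ ih
  | take x _ ih =>
    have := Sel.take (x - c) ih
    rw [List.map_cons]
    convert this using 1
    push_cast; ring

theorem UC.shift1 {l : List ℝ} {k : ℕ} {s : ℝ} (c : ℝ) (h : UC l k s) :
    UC (l.map (fun t => t - c)) k (s - k * c) := by
  obtain ⟨f, s', h, hs⟩ := h
  exact ⟨f, _, h.shift c, by linarith⟩

theorem UC.shift (l : List ℝ) (k : ℕ) (s : ℝ) (c : ℝ) :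
    UC l k s ↔ UC (l.map (fun t => t - c)) k (s - k * c) := by
  refine ⟨UC.shift1 c, fun h => ?_⟩
  have := UC.shift1 (-c) h
  rw [List.map_map] at this
  convert this using 1
  · symm
    convert List.map_id l using 2
    funext t; simp
  · ring

theorem Sel.nonneg {l : List ℝ} {b e : Bool} {k : ℕ} {s : ℝ} (h : Sel l b e k s) (hl : NN l) :
    0 ≤ s := by
  induction h with
  | nil b => exact le_rfl
  | skip x _ ih => exact ih hl.cons.2
  | take x _ ih => exact add_nonneg hl.cons.1 (ih hl.cons.2)

theorem Sel.weaken {l : List ℝ} {e : Bool} {k : ℕ} {s : ℝ} (h : Sel l true e k s) :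
    Sel l false e k s ∨ (l = [] ∧ e = true ∧ k = 0 ∧ s = 0) := by
  cases h with
  | nil => right; simp
  | skip x h => exact Or.inl (Sel.skip x h)

theorem Sel.remove {l : List ℝ} {b e : Bool} {k : ℕ} {s : ℝ} (h : Sel l b e (k + 1) s)
    (hl : NN l) : ∃ s' ≤ s, Sel l b e k s' ∨ (e = true ∧ Sel l b false k s') := by
  induction l generalizing b k s with
  | nil => cases h
  | cons x l ih =>
    cases h with
    | skip _ h =>
      obtain ⟨s', h1, h2⟩ := ih h hl.cons.2
      exact ⟨s', h1, h2.imp (Sel.skip x) (fun h => ⟨h.1, Sel.skip x h.2⟩)⟩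
    | take _ h =>
      rename_i s
      refine ⟨s, by linarith [hl.cons.1], ?_⟩
      rcases h.weaken with h | ⟨rfl, rfl, rfl, rfl⟩
      · exact Or.inl (Sel.skip x h)
      · exact Or.inr ⟨rfl, Sel.skip x (Sel.nil _)⟩

theorem UC.mono {l : List ℝ} {k : ℕ} {s : ℝ} (hl : NN l) (h : UC l (k + 1) s) : UC l k s := by
  obtain ⟨f, s', h, hs⟩ := h
  obtain ⟨s'', h1, h2⟩ := h.remove hl
  rcases h2 with h2 | ⟨rfl, h2⟩
  · exact ⟨f, s'', h2, h1.trans hs⟩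
  · rcases h2.weaken with h3 | h3
    · exact ⟨false, s'', h3, h1.trans hs⟩
    · simp at h3

theorem Sel.zero (l : List ℝ) : Sel l false false 0 0 := by
  induction l with
  | nil => exact Sel.nil _
  | cons x l ih => exact Sel.skip x ih

theorem Sel.zero_sum {l : List ℝ} {b e : Bool} {k : ℕ} {s : ℝ} (h : Sel l b e k s) (hk : k = 0) :
    s = 0 := by
  induction h with
  | nil b => rfl
  | skip x _ ih => exact ih hk
  | take x _ ih => omega

theorem UC.zero (l : List ℝ) (s : ℝ) : UC l 0 s ↔ 0 ≤ s := by
  constructor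
  · rintro ⟨f, s', h, hs⟩
    rw [h.zero_sum rfl] at hs; exact hs
  · intro h; exact ⟨false, 0, Sel.zero l, h⟩

theorem UC.nonneg {l : List ℝ} {k : ℕ} {s : ℝ} (hl : NN l) (h : UC l k s) : 0 ≤ s := by
  obtain ⟨f, s', h, hs⟩ := h
  exact (h.nonneg hl).trans hs

theorem UC.merge {a b : ℝ} {r : List ℝ} (ha : 0 ≤ a) (hb : 0 ≤ b) (hr : NN r) (k : ℕ) (s : ℝ) :
    UC (a :: 0 :: b :: r) (k + 1) s ↔ UC ((a + b) :: r) k s := by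
  constructor
  · rintro ⟨f, s', h, hs⟩
    have key : ∀ f s'', Sel r false f k s'' → s'' ≤ s → UC ((a + b) :: r) k s :=
      fun f s'' h hs => ⟨f, s'', Sel.skip _ h, hs⟩
    have key2 : ∀ f s'', Sel r true f k s'' → s'' ≤ s → UC ((a + b) :: r) k s := by
      intro f s'' h hs
      rcases h.weaken with h | ⟨rfl, rfl, rfl, rfl⟩
      · exact key _ _ h hs
      · exact key false 0 (Sel.nil _) hs
    have key3 : ∀ f s'', Sel r false f (k + 1) s'' → s'' ≤ s → UC ((a + b) :: r) k s := by
      intro f s'' h hs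
      obtain ⟨s3, h3, h4⟩ := h.remove hr
      rcases h4 with h4 | ⟨_, h4⟩
      · exact key _ _ h4 (h3.trans hs)
      · exact key _ _ h4 (h3.trans hs)
    cases h with
    | skip _ h =>
      cases h with
      | skip _ h =>
        cases h with
        | skip _ h => exact key3 _ _ h hs
        | take _ h => exact key2 _ _ h (by linarith)
      | take _ h =>
        cases h with
        | skip _ h => exact key _ _ h (by linarith)
    | take _ h =>
      cases h with
      | skip _ h =>
        cases h with
        | skip _ h => exact key _ _ h (by linarith)
        | take _ h => exact ⟨false, _, Sel.take (a + b) h, by linarith⟩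
  · rintro ⟨f, s', h, hs⟩
    cases h with
    | skip _ h =>
      exact ⟨f, _, Sel.skip a (Sel.take 0 (Sel.skip b h)), by linarith⟩
    | take _ h =>
      exact ⟨false, _, Sel.take a (Sel.skip 0 (Sel.take b h)), by linarith⟩

theorem UC.pair {a : ℝ} (ha : 0 ≤ a) (k : ℕ) (s : ℝ) : UC [a, 0] (k + 1) s ↔ UC [] k s := by
  constructor
  · rintro ⟨f, s', h, hs⟩
    have fin : ∀ {b f k s''}, Sel [] b f k s'' → s'' ≤ s → UC [] k s := by
      intro b f k s'' h hs
      cases h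
      exact ⟨b, 0, Sel.nil _, hs⟩
    cases h with
    | skip _ h =>
      cases h with
      | skip _ h => cases h
      | take _ h => exact fin h (by linarith)
    | take _ h =>
      cases h with
      | skip _ h => exact fin h (by linarith)
  · rintro ⟨f, s', h, hs⟩
    cases h
    exact ⟨true, _, Sel.skip a (Sel.take 0 (Sel.nil _)), by linarith⟩

/-! ### Reductions -/

def Red (r : ℕ) (l l' : List ℝ) : Prop :=
  l.length = l'.length + 2 * r ∧ ∀ k s, UC l (k + r) s ↔ UC l' k s

theorem Red.refl (l : List ℝ) : Red 0 l l := ⟨rfl, fun _ _ => Iff.rfl⟩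

theorem Red.trans {r t : ℕ} {l m n : List ℝ} (h : Red r l m) (h' : Red t m n) :
    Red (t + r) l n :=
  ⟨by have := h.1; have := h'.1; omega, fun k s => by rw [← add_assoc, h.2, h'.2]⟩

theorem Red.rot (l m : List ℝ) : Red 0 (l ++ m) (m ++ l) :=
  ⟨by simp [add_comm], fun k s => UC.rot l m k s⟩

theorem Red.merge {a b : ℝ} {r : List ℝ} (ha : 0 ≤ a) (hb : 0 ≤ b) (hr : NN r) :
    Red 1 (a :: 0 :: b :: r) ((a + b) :: r) := ⟨by simp, UC.merge ha hb hr⟩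

theorem Red.small {r : ℕ} {l l' : List ℝ} (h : Red r l l') (hl : NN l) {k : ℕ} (hk : k ≤ r)
    (s : ℝ) : UC l k s ↔ 0 ≤ s := by
  refine ⟨UC.nonneg hl, fun hs => ?_⟩
  have h0 : UC l r s := by
    have := (h.2 0 s).2 ((UC.zero _ _).2 hs)
    simpa using this
  clear h
  induction r with
  | zero => obtain rfl : k = 0 := by omega
            exact h0
  | succ r ih =>
    rcases Nat.lt_or_ge r k with h1 | h1
    · obtain rfl : k = r + 1 := by omega
      exact h0
    · exact ih h1 (UC.mono hl h0)

def addHead (c : ℝ) : List ℝ → List ℝ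
  | [] => []
  | h :: t => (h + c) :: t

inductive SQ : List ℝ → List ℝ → ℝ → Prop
  | one (a : ℝ) : SQ [a] [a] 0
  | last (a : ℝ) : SQ [a, 0] [] a
  | merge {a b : ℝ} {r o : List ℝ} {c : ℝ} : SQ ((a + b) :: r) o c → SQ (a :: 0 :: b :: r) o c
  | keep {a b : ℝ} {r o : List ℝ} {c : ℝ} : b ≠ 0 → SQ (b :: r) o c →
      SQ (a :: b :: r) (a :: o) c

theorem SQ.red {l o : List ℝ} {c : ℝ} (h : SQ l o c) (hl : NN l) (pre : List ℝ) (hp : NN pre) :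
    ∃ n, Red n (pre ++ l) (addHead c (pre ++ o)) := by
  induction h generalizing pre with
  | one a =>
    refine ⟨0, ?_⟩
    have : addHead 0 (pre ++ [a]) = pre ++ [a] := by
      cases pre <;> simp [addHead]
    rw [this]; exact Red.refl _
  | last a =>
    cases pre with
    | nil => exact ⟨1, by simp [addHead], by simpa [addHead] using UC.pair hl.cons.1⟩
    | cons h t =>
      refine ⟨_, (Red.rot _ _).trans (t := 1) (n := addHead a (h :: t ++ [])) ?_⟩
      · have := Red.merge (a := a) (b := h) hl.cons.1 hp.cons.1 hp.cons.2
        simpa [addHead, add_comm] using this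
  | @merge a b r o c _ ih =>
    have h1 := hl.cons.1
    have h2 := hl.cons.2.cons.2.cons.1
    have h3 := hl.cons.2.cons.2.cons.2
    obtain ⟨n, hn⟩ := ih (NN.mk (add_nonneg h1 h2) h3) pre hp
    have hm := Red.merge (r := r ++ pre) h1 h2 (h3.append hp)
    exact ⟨_, (((Red.rot _ _).trans hm).trans (Red.rot ((a + b) :: r) pre)).trans hn⟩
  | @keep a b r o c _ _ ih =>
    obtain ⟨n, hn⟩ := ih hl.cons.2 (pre ++ [a]) (hp.append (NN.mk hl.cons.1 (by simp [NN])))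
    exact ⟨n, by simpa using hn⟩

theorem SQ.c_nonneg {l o : List ℝ} {c : ℝ} (h : SQ l o c) (hl : NN l) : 0 ≤ c := by
  induction h with
  | one a => exact le_rfl
  | last a => exact hl.cons.1
  | merge _ ih =>
    exact ih (NN.mk (add_nonneg hl.cons.1 hl.cons.2.cons.2.cons.1) hl.cons.2.cons.2.cons.2)
  | keep _ _ ih => exact ih hl.cons.2

theorem SQ.len {l o : List ℝ} {c : ℝ} (h : SQ l o c) :
    o.length ≤ l.length ∧ (0 ∈ l.tail → o.length < l.length) := by
  induction h with
  | one a => simp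
  | last a => simp
  | merge _ ih => simp at ih ⊢; omega
  | @keep a b r o c hb _ ih =>
    simp at ih ⊢
    refine ⟨ih.1, ?_⟩
    rintro (h | h)
    · exact absurd h.symm hb
    · exact ih.2 h

/-- Up/down path stays nonnegative after each down step. -/
def Gd : Bool → ℝ → List ℝ → Prop
  | _, _, [] => True
  | true, h, a :: l => Gd false (h + a) l
  | false, h, a :: l => 0 ≤ h - a ∧ Gd true (h - a) l

theorem Gd.mono {l : List ℝ} : ∀ {b : Bool} {h h' : ℝ}, h ≤ h' → Gd b h l → Gd b h' l := by
  induction l with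
  | nil => intro b; cases b <;> simp [Gd]
  | cons a l ih =>
    intro b h h' hh hg
    cases b with
    | true => exact ih (by linarith) hg
    | false => exact ⟨by linarith [hg.1], ih (by linarith) hg.2⟩

theorem SQ.gd {l o : List ℝ} {c : ℝ} (hs : SQ l o c) : ∀ {b : Bool} {h : ℝ}, 
    Gd b h l → Gd b h o := by
  induction hs with
  | one a => exact id
  | last a => intro b; cases b <;> simp [Gd]
  | merge _ ih =>
    intro s h hg
    apply ih
    cases s with
    | true => simp only [Gd, sub_zero] at hg ⊢; rw [← add_assoc]; exact hg.2
    | false => simp only [Gd, add_zero] at hg ⊢; rw [← sub_sub]; exact hg.2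
  | keep _ _ ih =>
    intro s h hg
    cases s with
    | true => simp only [Gd] at hg ⊢; exact ih hg
    | false => simp only [Gd] at hg ⊢; exact ⟨hg.1, ih hg.2⟩

theorem Gd.addHead {l : List ℝ} {c : ℝ} (hc : 0 ≤ c) (h : Gd true 0 l) :
    Gd true 0 (addHead c l) := by
  cases l with
  | nil => exact h
  | cons a l => 
    have h' : Gd false (0 + a) l := h
    show Gd false (0 + (a + c)) l
    exact Gd.mono (by linarith) h'

theorem SQ.zeros {a : ℝ} {r o : List ℝ} {c : ℝ} (j : ℕ) (h : SQ (a :: r) o c) :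
    SQ (a :: (List.replicate (2 * j) 0 ++ r)) o c := by
  induction j with
  | zero => simpa using h
  | succ j ih =>
    rw [show 2 * (j + 1) = 2 * j + 1 + 1 by ring, List.replicate_succ, List.replicate_succ]
    apply SQ.merge
    rw [add_zero]; exact ih

theorem takeWhile_zero (l : List ℝ) :
    ∃ m r, (l.takeWhile (fun t => decide (t = 0))).length = m ∧ l = List.replicate m 0 ++ r ∧
      l.drop m = r ∧ ∀ h t, r = h :: t → h ≠ 0 := by
  induction l with
  | nil => exact ⟨0, [], by simp⟩
  | cons x l ih =>
    by_cases hx : x = 0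
    · obtain ⟨m, r, h1, h2, h3, h4⟩ := ih
      refine ⟨m + 1, r, by simp [hx, h1], ?_, by simpa using h3, h4⟩
      rw [List.replicate_succ, List.cons_append, ← h2, hx]
    · refine ⟨0, x :: l, by simp [hx], by simp, by simp, ?_⟩
      rintro h t ⟨⟩
      exact hx

theorem squashF_SQ (fuel : ℕ) : ∀ (a : ℝ) (rest : List ℝ), rest.length < fuel →
    SQ (a :: rest) (squashF fuel (a :: rest)).1 (squashF fuel (a :: rest)).2 := by
  induction fuel with
  | zero => intro a rest h; omega
  | succ fuel ih =>
    intro a rest hf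
    obtain ⟨m, r, h1, h2, h3, h4⟩ := takeWhile_zero rest
    have hlen : rest.length = m + r.length := by rw [h2]; simp
    simp only [squashF, h1, h3]
    rw [h2]
    rcases Nat.even_or_odd' m with ⟨j, rfl | rfl⟩
    · cases r with
      | nil => simpa using SQ.zeros (r := []) j (SQ.one a)
      | cons b r =>
        have hb := h4 b r rfl
        simp only [reduceCtorEq, if_false, even_two, Even.mul_right, if_true, List.headI,
          List.tail]
        exact SQ.zeros j (SQ.keep hb (ih b r (by simp at hlen; omega)))
    · have ho : ¬ Even (2 * j + 1) := by simp
      rw [List.replicate_succ', List.append_assoc]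
      apply SQ.zeros
      cases r with
      | nil => simpa [ho] using SQ.last a
      | cons b r =>
        simp only [reduceCtorEq, if_false, ho, List.headI, List.tail]
        exact SQ.merge (ih (a + b) r (by simp at hlen; omega))

theorem lead_red (n : ℕ) : ∀ l r : List ℝ, ∀ m, l = List.replicate m 0 ++ r → m ≤ n → Even l.length →
    NN l → Gd true 0 l → (∀ h t, r = h :: t → h ≠ 0) → 
    (∃ d, Red d l r) ∧ Gd true 0 r := by
  induction n using Nat.strong_induction_on with
  | _ n ih =>
  intro l r m h1 hm hev hnn hg hr
  match m with
  | 0 => simp at h1; subst h1; exact ⟨⟨0, Red.refl _⟩, hg⟩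
  | 1 =>
    exfalso
    simp at h1
    subst h1
    cases r with
    | nil => simp at hev
    | cons b r =>
      have hb := hr b r rfl
      have := hnn.cons.2.cons.1
      simp only [Gd] at hg
      exact hb (by linarith [hg.1])
  | m + 2 =>
    rw [List.replicate_succ, List.replicate_succ] at h1
    simp only [List.cons_append] at h1
    subst h1
    simp only [Gd, add_zero, sub_zero] at hg
    have hnn' := hnn.cons.2.cons.2
    obtain ⟨⟨d, hd⟩, h2⟩ := ih (n - 1) (by omega) _ r m rfl (by omega)
      (by simp only [List.length_cons] at hev
          rw [Nat.even_add_one, Nat.even_add_one, not_not] at hev; exact hev) hnn' hg.2 hr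
    refine ⟨?_, h2⟩
    obtain ⟨e, he⟩ := SQ.red (SQ.last 0) (by simp [NN]) (List.replicate m 0 ++ r) hnn'
    have h0 : addHead 0 (List.replicate m 0 ++ r ++ []) = List.replicate m 0 ++ r := by
      rw [List.append_nil]
      cases (List.replicate m 0 ++ r) <;> simp [addHead]
    rw [h0] at he
    exact ⟨_, ((Red.rot [0, 0] _).trans he).trans hd⟩

theorem foldr_min_spec (l : List ℝ) (x : ℝ) : (∀ t ∈ l, l.foldr min x ≤ t) ∧
    (l.foldr min x = x ∨ l.foldr min x ∈ l) := by
  induction l with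
  | nil => simp
  | cons a l ih =>
    simp only [List.foldr_cons, List.mem_cons, forall_eq_or_imp]
    refine ⟨⟨min_le_left _ _, fun t ht => (min_le_right _ _).trans (ih.1 t ht)⟩, ?_⟩
    rcases min_choice a (l.foldr min x) with h | h <;> rw [h]
    · simp
    · rcases ih.2 with h | h
      · exact Or.inl h
      · exact Or.inr (Or.inr h)

theorem minL_spec {l : List ℝ} (hl : l ≠ []) : (∀ t ∈ l, minL l ≤ t) ∧ minL l ∈ l := by
  refine ⟨(foldr_min_spec l _).1, ?_⟩
  rcases (foldr_min_spec l l.headI).2 with h | h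
  · unfold minL
    rw [h]
    cases l with
    | nil => exact absurd rfl hl
    | cons a l => simp
  · exact h

theorem Gd.shift {c : ℝ} (l : List ℝ) : ∀ {h : ℝ},
    (Gd true h l → Gd true h (l.map (fun t => t - c))) ∧
    (Gd false h l → Gd false (h - c) (l.map (fun t => t - c))) := by
  induction l with
  | nil => intro h; simp [Gd]
  | cons a l ih =>
    intro h
    simp only [Gd, List.map_cons]
    refine ⟨fun hg => ?_, fun hg => ?_⟩
    · have := ih.2 hg
      rwa [add_sub_assoc] at this
    · rw [sub_sub_sub_cancel_right]
      exact ⟨hg.1, ih.1 hg.2⟩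

theorem stepA_spec {x : List ℝ} (hx : x ≠ []) (hev : Even x.length) (hg : Gd true 0 x) :
    (∃ r, Red r (x.map (fun t => t - minL x)) (stepA x)) ∧ Gd true 0 (stepA x) ∧
      (stepA x).length < x.length ∧ NN (x.map (fun t => t - minL x)) := by
  obtain ⟨hm1, hm2⟩ := minL_spec hx
  have hnn : NN (x.map (fun t => t - minL x)) := by
    intro t ht
    obtain ⟨u, hu, rfl⟩ := List.mem_map.1 ht
    have := hm1 u hu
    linarith
  have h0 : (0 : ℝ) ∈ x.map (fun t => t - minL x) :=
    List.mem_map.2 ⟨_, hm2, by simp⟩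
  have hgy := (Gd.shift (c := minL x) x).1 hg
  have hlen : (x.map (fun t => t - minL x)).length = x.length := by simp
  have hst : stepA x = addHead (contract (x.map (fun t => t - minL x))).2
      (contract (x.map (fun t => t - minL x))).1 := by
    unfold stepA
    split <;> rename_i h <;> rw [h] <;> rfl
  rw [hst]
  rw [← hlen] at hev ⊢
  generalize x.map (fun t => t - minL x) = y at *
  obtain ⟨m, r, h1, h2, h3, h4⟩ := takeWhile_zero y
  obtain ⟨⟨d, hd⟩, hgr⟩ := lead_red m y r m h2 le_rfl hev hnn hgy h4
  have hlr : y.length = m + r.length := by rw [h2]; simp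
  simp only [contract, h1, h3]
  cases r with
  | nil =>
    simp only [List.length_nil, squashF, addHead]
    refine ⟨⟨d, hd⟩, hgr, List.length_pos_of_mem h0, hnn⟩
  | cons a r =>
    have hsq := squashF_SQ (a :: r).length a r (by simp)
    have hnr : NN (a :: r) := by rw [h2] at hnn; exact hnn.app.2
    obtain ⟨n, hn⟩ := hsq.red hnr [] (by simp [NN])
    refine ⟨⟨_, hd.trans hn⟩, Gd.addHead (hsq.c_nonneg hnr) (hsq.gd hgr), ?_, hnn⟩
    have hl : ∀ c l, (addHead c l).length = l.length := by
      intro c l; cases l <;> simp [addHead]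
    rw [hl]
    have := hsq.len
    rcases Nat.eq_zero_or_pos m with hm | hm
    · subst hm
      have h5 : (0 : ℝ) ∈ (a :: r).tail := by
        simp only [List.replicate_zero, List.nil_append] at h2
        rw [h2] at h0
        rcases List.mem_cons.1 h0 with h | h
        · exact absurd h.symm (h4 a r rfl)
        · exact h
      have := this.2 h5
      omega
    · have := this.1; omega

def partsL : ℝ → List (ℝ × ℕ) → List ℝ
  | _, [] => []
  | acc, p :: t => List.replicate p.2 (acc + p.1) ++ partsL (acc + p.1) t

theorem diagMS_eq (l : List (ℝ × ℕ)) : ∀ acc, diagMS acc l = (partsL acc l : Multiset ℝ) := by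
  induction l with
  | nil => intro acc; rfl
  | cons p t ih =>
    intro acc
    simp only [diagMS, partsL, ih, ← Multiset.coe_add, Multiset.coe_replicate]

theorem alg_spec (fuel : ℕ) : ∀ (x : List ℝ) (acc : ℝ), x.length ≤ fuel → Even x.length →
    Gd true 0 x → (partsL acc (algStepsA fuel x)).length = x.length / 2 ∧
    ∀ k ≤ x.length / 2, ∀ s,
      (UC x k s ↔ ((partsL acc (algStepsA fuel x)).take k).sum ≤ s + k * acc) := by
  have hnil : ∀ fuel, ∀ acc : ℝ, (partsL acc (algStepsA fuel [])).length = ([] : List ℝ).length / 2 ∧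
    ∀ k ≤ ([] : List ℝ).length / 2, ∀ s,
      (UC [] k s ↔ ((partsL acc (algStepsA fuel [])).take k).sum ≤ s + k * acc) := by
    intro fuel acc
    have : algStepsA fuel [] = [] := by cases fuel <;> rfl
    rw [this]
    refine ⟨rfl, fun k hk s => ?_⟩
    obtain rfl : k = 0 := by simpa using hk
    simpa using UC.zero [] s
  induction fuel with
  | zero =>
    intro x acc hf _ _
    obtain rfl : x = [] := by simpa using hf
    exact hnil _ _
  | succ fuel ih =>
    intro x acc hf hev hg
    by_cases hx : x = []
    · subst hx; exact hnil _ _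
    obtain ⟨⟨r, hr⟩, hg', hl, hnn⟩ := stepA_spec hx hev hg
    have hlen := hr.1
    rw [List.length_map] at hlen
    have hev' : Even (stepA x).length := by
      rw [hlen, Nat.even_add] at hev
      exact hev.2 (by simp)
    obtain ⟨i1, i2⟩ := ih (stepA x) (acc + minL x) (by omega) hev' hg'
    have hst : algStepsA (fuel + 1) x
        = (minL x, r) :: algStepsA fuel (stepA x) := by
      have h2 : x.length / 2 - (stepA x).length / 2 = r := by omega
      cases x with
      | nil => exact absurd rfl hx
      | cons a x => simp only [algStepsA, h2]
    rw [hst]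
    simp only [partsL]
    refine ⟨by rw [List.length_append, i1, List.length_replicate]; omega, fun k hk s => ?_⟩
    rw [UC.shift x k s (minL x)]
    rcases Nat.le_total k r with h | h
    · rw [hr.small hnn h, List.take_append_of_le_length (by simpa using h)]
      rw [List.take_replicate, min_eq_left h, List.sum_replicate, nsmul_eq_mul]
      constructor <;> intro h <;> nlinarith
    · obtain ⟨j, rfl⟩ : ∃ j, k = j + r := ⟨k - r, by omega⟩
      rw [hr.2, i2 j (by omega), List.take_append, List.length_replicate,
        List.take_replicate, min_eq_right h, List.sum_append, List.sum_replicate, nsmul_eq_mul,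
        Nat.add_sub_cancel]
      push_cast
      constructor <;> intro h <;> nlinarith

theorem HWC_Gd (n : ℕ) : ∀ (l : List ℝ) (h : ℝ), l.length = 2 * n →
    (∀ k : ℕ, 2 * k ≤ l.length →
    0 ≤ h + ∑ j ∈ Finset.range k, (l.getD (2 * j) 0 - l.getD (2 * j + 1) 0)) → Gd true h l := by
  induction n with
  | zero => intro l h hl _; obtain rfl : l = [] := by simpa using hl
            trivial
  | succ n ih =>
    intro l h hl hk
    match l, hl with
    | a :: b :: l, hl =>
      simp only [List.length_cons] at hl hk
      refine ⟨?_, ih l _ (by omega) fun k hk' => ?_⟩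
      · have := hk 1 (by omega)
        simp at this; linarith
      · have := hk (k + 1) (by omega)
        rw [Finset.sum_range_succ'] at this
        simp only [mul_add, mul_one, List.getD_cons_succ, mul_zero, List.getD_cons_zero, zero_add] at this
        linarith

theorem youngMS_eq (n : ℕ) (x y : List ℝ) (hx : x.length = 2 * n) (hy : y.length = 2 * n)
    (hgx : HWC x) (hgy : HWC y) (h : ∀ k s, UC x k s ↔ UC y k s) : youngMS x = youngMS y := by
  obtain ⟨x1, x2⟩ := alg_spec x.length x 0 le_rfl (by simp [hx]) (HWC_Gd n x 0 hx (by simpa [HWC] using hgx))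
  obtain ⟨y1, y2⟩ := alg_spec y.length y 0 le_rfl (by simp [hy]) (HWC_Gd n y 0 hy (by simpa [HWC] using hgy))
  unfold youngMS
  rw [diagMS_eq, diagMS_eq]
  generalize partsL 0 (algStepsA x.length x) = P at *
  generalize partsL 0 (algStepsA y.length y) = Q at *
  have hlen : P.length = Q.length := by omega
  have key : ∀ k ≤ n, (P.take k).sum = (Q.take k).sum := by
    intro k hk
    have hh : ∀ s, (P.take k).sum ≤ s ↔ (Q.take k).sum ≤ s := by
      intro s
      have e1 := x2 k (by omega) s
      have e2 := y2 k (by omega) s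
      simp only [mul_zero, add_zero] at e1 e2
      rw [← e1, ← e2, h]
    exact le_antisymm ((hh _).2 le_rfl) ((hh _).1 le_rfl)
  congr 1
  apply List.ext_getElem hlen
  intro i h1 h2
  have a := key i (by omega)
  have b := key (i + 1) (by omega)
  rw [List.take_succ_eq_append_getElem h1, List.take_succ_eq_append_getElem h2,
    List.sum_append, List.sum_append, List.sum_singleton, List.sum_singleton] at b
  linarith

/-! ### The time evolution -/

inductive Run : ℝ → List ℝ → List ℝ → ℝ → Prop
  | nil (X : ℝ) : Run X [] [] X
  | cons {X a c Y : ℝ} {l l' : List ℝ} : Run (c + X - min a X) l l' Y →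
      Run X (a :: c :: l) (min a X :: (a + c - min a X) :: l') Y

theorem Run.trans {X Y Z : ℝ} {l l' m m' : List ℝ} (h : Run X l l' Y) (h' : Run Y m m' Z) :
    Run X (l ++ m) (l' ++ m') Z := by
  induction h with
  | nil => exact h'
  | cons _ ih => exact Run.cons (ih h')

theorem Run.length {X Y : ℝ} {l l' : List ℝ} (h : Run X l l' Y) : l'.length = l.length := by
  induction h with
  | nil => rfl
  | cons _ ih => simp [ih]

theorem Run.findZero {X Y : ℝ} {l l' : List ℝ} (h : Run X l l' Y) (h0 : (0 : ℝ) ∈ l) :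
    ∃ l1 l1' a c l2 l2' X1, l = l1 ++ a :: c :: l2 ∧ l' = l1' ++ l2' ∧
      (a = 0 ∨ c = 0) ∧ Run X l1 l1' X1 ∧ Run X1 (a :: c :: l2) l2' Y := by
  induction h with
  | nil => simp at h0
  | @cons X a c Y l l' h ih =>
    by_cases hz : a = 0 ∨ c = 0
    · exact ⟨[], [], a, c, l, _, X, rfl, rfl, hz, Run.nil _, Run.cons h⟩
    · have : (0 : ℝ) ∈ l := by
        simp only [List.mem_cons] at h0
        rcases h0 with h | h | h
        · exact absurd (Or.inl h.symm) hz
        · exact absurd (Or.inr h.symm) hz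
        · exact h
      obtain ⟨l1, l1', a', c', l2, l2', X1, h1, h2, h3, h4, h5⟩ := ih this
      exact ⟨_, _, a', c', l2, l2', X1, by rw [h1]; rfl, by rw [h2]; rfl, h3, Run.cons h4, h5⟩

theorem Run.snoc {X Y : ℝ} {l l' : List ℝ} (h : Run X l l' Y) (hl : l ≠ []) :
    ∃ l0 l0' m' a c X0, l = l0 ++ [a, c] ∧ l' = l0' ++ m' ∧ Run X l0 l0' X0 ∧
      Run X0 [a, c] m' Y := by
  induction h with
  | nil => exact absurd rfl hl
  | @cons X a c Y l l' h ih =>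
    by_cases hz : l = []
    · subst hz
      exact ⟨[], [], _, a, c, X, rfl, rfl, Run.nil _, Run.cons h⟩
    · obtain ⟨l0, l0', m', a', c', X0, h1, h2, h3, h4⟩ := ih hz
      exact ⟨_, _, m', a', c', X0, by rw [h1]; rfl, by rw [h2]; rfl, Run.cons h3, h4⟩

theorem Run.shift {X Y : ℝ} {l l' : List ℝ} (μ : ℝ) (h : Run X l l' Y) :
    Run (X - μ) (l.map (fun t => t - μ)) (l'.map (fun t => t - μ)) (Y - μ) := by
  induction h with
  | nil => exact Run.nil _
  | @cons X a c Y l l' h ih =>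
    have e : min (a - μ) (X - μ) = min a X - μ := min_sub_sub_right a X μ
    simp only [List.map_cons]
    have := Run.cons (X := X - μ) (a := a - μ) (c := c - μ) (l := l.map (fun t => t - μ))
      (l' := l'.map (fun t => t - μ)) (Y := Y - μ)
      (by rw [e]; convert ih using 1; ring)
    rw [e] at this
    convert this using 3
    ring

theorem Run.nn {X Y : ℝ} {l l' : List ℝ} (h : Run X l l' Y) (hX : 0 ≤ X) (hl : NN l) :
    NN l' := by
  induction h with
  | nil => exact hl
  | @cons X a c Y l l' h ih =>
    have ha := hl.cons.1
    have hc := hl.cons.2.cons.1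
    have h1 : min a X ≤ X := min_le_right _ _
    have h2 : min a X ≤ a := min_le_left _ _
    exact NN.mk (le_min ha hX) (NN.mk (by linarith) (ih (by linarith) hl.cons.2.cons.2))

theorem Run.nnX {X Y : ℝ} {l l' : List ℝ} (h : Run X l l' Y) (hn : l ≠ []) (hl : NN l) :
    0 ≤ Y := by
  induction h with
  | nil => exact absurd rfl hn
  | @cons X a c Y l l' h ih =>
    have hc := hl.cons.2.cons.1
    have h1 : min a X ≤ X := min_le_right _ _
    by_cases hz : l = []
    · subst hz
      cases h
      linarith
    · exact ih hz hl.cons.2.cons.2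

theorem UC.merge2 {u v w : ℝ} {r : List ℝ} (hu : 0 ≤ u) (hv : 0 ≤ v) (hw : 0 ≤ w) (hr : NN r)
    (k : ℕ) (s : ℝ) : UC (u :: v :: 0 :: w :: r) (k + 1) s ↔ UC (u :: (v + w) :: r) k s := by
  have h1 := UC.rot [u] (v :: 0 :: w :: r) (k + 1) s
  have h2 := UC.merge (r := r ++ [u]) hv hw (hr.append (NN.mk hu (by simp [NN]))) k s
  have h3 := UC.rot [u] ((v + w) :: r) k s
  exact h1.trans (h2.trans h3.symm)

/-- Reduction of a closed run whose first `down` entry or whose second `up` entry vanishes. -/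
theorem Run.reduce {X : ℝ} {l l' : List ℝ} {a0 c0 a1 c1 : ℝ}
    (h : Run X (a0 :: c0 :: a1 :: c1 :: l) l' X) (hz : a1 = 0 ∨ c0 = 0)
    (hl : NN (a0 :: c0 :: a1 :: c1 :: l)) :
    ∃ m m', Run X m m' X ∧ m.length = l.length + 2 ∧
      (∀ k s, UC (a0 :: c0 :: a1 :: c1 :: l) (k + 1) s ↔ UC m k s) ∧
      (∀ k s, UC l' (k + 1) s ↔ UC m' k s) := by
  have hX := h.nnX (by simp) hl
  have hl' := h.nn hX hl
  have ha0 := hl.cons.1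
  have hc0 := hl.cons.2.cons.1
  have ha1 := hl.cons.2.cons.2.cons.1
  have hc1 := hl.cons.2.cons.2.cons.2.cons.1
  have hnl := hl.cons.2.cons.2.cons.2.cons.2
  cases h with
  | cons h =>
  cases h with
  | @cons _ _ _ _ _ l'' h =>
  have hp0 := hl'.cons.1
  have hq0 := hl'.cons.2.cons.1
  have hp1 := hl'.cons.2.cons.2.cons.1
  have hq1 := hl'.cons.2.cons.2.cons.2.cons.1
  have hnl' := hl'.cons.2.cons.2.cons.2.cons.2
  rcases hz with rfl | rfl
  · have hX1 : 0 ≤ c0 + X - min a0 X := by linarith [min_le_right a0 X]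
    rw [min_eq_left hX1] at h ⊢
    have hr : Run X (a0 :: (c0 + c1) :: l) (min a0 X :: (a0 + (c0 + c1) - min a0 X) :: l'') X := by
      apply Run.cons
      convert h using 1; ring
    refine ⟨_, _, hr, by simp, UC.merge2 ha0 hc0 hc1 hnl, fun k s => ?_⟩
    rw [UC.merge2 hp0 hq0 (by linarith) hnl']
    rw [show a0 + c0 - min a0 X + (0 + c1 - 0) = a0 + (c0 + c1) - min a0 X by ring]
  · have hr : Run X ((a0 + a1) :: c1 :: l)
      (min (a0 + a1) X :: (a0 + a1 + c1 - min (a0 + a1) X) :: l'') X := by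
      apply Run.cons
      convert h using 1
      rcases le_total X a0 with hx | hx
      · rw [min_eq_right hx, min_eq_right (show X ≤ a0 + a1 by linarith),
          min_eq_right (show 0 + X - X ≤ a1 by linarith)]; ring
      · rw [min_eq_left hx]
        rcases le_total X (a0 + a1) with hy | hy
        · rw [min_eq_right hy, min_eq_right (show 0 + X - a0 ≤ a1 by linarith)]; ring
        · rw [min_eq_left hy, min_eq_left (show a1 ≤ 0 + X - a0 by linarith)]; ring
    refine ⟨_, _, hr, by simp, UC.merge ha0 ha1 (NN.mk hc1 hnl), fun k s => ?_⟩
    rcases le_total X a0 with hx | hx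
    · rw [min_eq_right (show X ≤ a0 + a1 by linarith)]
      rw [min_eq_right hx] at hq0 hq1 ⊢
      have e : min a1 (0 + X - X) = 0 := by
        rw [min_eq_right (show 0 + X - X ≤ a1 by linarith)]; ring
      rw [e] at hq1 ⊢
      rw [UC.merge2 hX hq0 hq1 hnl']
      rw [show a0 + 0 - X + (a1 + c1 - 0) = a0 + a1 + c1 - X by ring]
    · rw [min_eq_left hx] at hp1 hq1 ⊢
      rw [show a0 + 0 - a0 = 0 by ring]
      rw [UC.merge ha0 hp1 (NN.mk hq1 hnl')]
      have e : a0 + min a1 (0 + X - a0) = min (a0 + a1) X := by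
        rw [← min_add_add_left]; congr 1; ring
      rw [e]
      rw [show a1 + c1 - min a1 (0 + X - a0) = a0 + a1 + c1 - min (a0 + a1) X by rw [← e]; ring]

theorem Run.conserved (n : ℕ) : ∀ (X : ℝ) (l l' : List ℝ), l.length = 2 * n → Run X l l' X →
    ∀ k s, UC l k s ↔ UC l' k s := by
  induction n with
  | zero =>
    intro X l l' hl h k s
    obtain rfl : l = [] := by simpa using hl
    cases h; rfl
  | succ n ih =>
    intro X l l' hl h k s
    rcases Nat.eq_zero_or_pos n with hn | hn
    · subst hn
      match l, hl with
      | [a, c], _ =>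
        cases h with
        | cons h =>
          have e : c + X - min a X = X := by
            generalize hz : c + X - min a X = Z at h
            cases h; rfl
          have hc : min a X = c := by linarith
          rw [e] at h
          cases h
          rw [hc, add_sub_cancel_right]
          exact UC.rot [a] [c] k s
    · cases k with
      | zero => rw [UC.zero, UC.zero]
      | succ k =>
      have hne : l ≠ [] := by rintro rfl; simp at hl
      obtain ⟨hm1, hm2⟩ := minL_spec hne
      rw [UC.shift l _ s (minL l), UC.shift l' _ s (minL l)]
      have hr := h.shift (minL l)
      have hnn : NN (l.map (fun t => t - minL l)) := by
        intro t ht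
        obtain ⟨u, hu, rfl⟩ := List.mem_map.1 ht
        have := hm1 u hu
        linarith
      have h0 : (0 : ℝ) ∈ l.map (fun t => t - minL l) :=
        List.mem_map.2 ⟨_, hm2, by simp⟩
      have hlen : (l.map (fun t => t - minL l)).length = 2 * (n + 1) := by simp [hl]
      generalize s - _ = s0
      generalize X - minL l = X0 at hr
      generalize l'.map (fun t => t - minL l) = y' at *
      generalize l.map (fun t => t - minL l) = y at *
      obtain ⟨l1, l1', a, c, l2, l2', X1, rfl, rfl, h3, h4, h5⟩ := hr.findZero h0
      rw [UC.rot l1, UC.rot l1']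
      have hr2 := h5.trans h4
      have hnn2 : NN ((a :: c :: l2) ++ l1) := hnn.app.2.append hnn.app.1
      have hlen2 : ((a :: c :: l2) ++ l1).length = 2 * (n + 1) := by
        rw [← hlen]; simp; omega
      have fin : ∀ (X : ℝ) (a0 c0 : ℝ) (l l' : List ℝ) (a1 c1 : ℝ),
          Run X (a0 :: c0 :: a1 :: c1 :: l) l' X → (a1 = 0 ∨ c0 = 0) →
          NN (a0 :: c0 :: a1 :: c1 :: l) → l.length + 4 = 2 * (n + 1) →
          (UC (a0 :: c0 :: a1 :: c1 :: l) (k + 1) s0 ↔ UC l' (k + 1) s0) := by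
        intro X a0 c0 l l' a1 c1 h hz hl hln
        obtain ⟨m, m', e1, e2, e3, e4⟩ := h.reduce hz hl
        rw [e3, e4]
        exact ih X m m' (by omega) e1 k s0
      generalize l2' ++ l1' = z' at *
      rw [List.cons_append, List.cons_append] at *
      generalize l2 ++ l1 = z at *
      simp only [List.length_cons] at hlen2
      rcases h3 with rfl | rfl
      · have hz : z ≠ [] := by rintro rfl; simp at hlen2; omega
        obtain ⟨l0, l0', m', a', c', X0', f1, f2, f3, f4⟩ := hr2.snoc (by simp)
        have hr3 := f4.trans f3
        rw [f1, f2, UC.rot l0, UC.rot l0']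
        match l0, f1 with
        | [], f1 => simp at f1; exact absurd f1.2.2 hz
        | [b], f1 => simp at f1; 
                     obtain ⟨_, _, rfl⟩ := f1
                     simp at hlen2; omega
        | b :: c'' :: t, f1 =>
          have f1' := f1
          simp only [List.cons_append, List.cons.injEq] at f1
          obtain ⟨rfl, rfl, rfl⟩ := f1
          apply fin _ _ _ _ _ _ _ hr3 (Or.inl rfl)
          · intro u hu
            apply hnn2
            simp at hu ⊢; tauto
          · simp at hlen2; omega
      · match z, hlen2 with
        | [], hlen2 => simp at hlen2; omega
        | [b], hlen2 => simp at hlen2; omega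
        | a1 :: c1 :: t, hlen2 =>
          exact fin _ _ _ _ _ _ _ hr2 (Or.inr rfl) hnn2 (by simp at hlen2; omega)

theorem UC.window (M : ℕ) (B : ℕ → ℝ) (hB : ∀ n, B (n + M) = B n) (c : ℕ) (k : ℕ) (s : ℝ) :
    UC ((List.range M).map (fun j => B (c + j))) k s ↔ UC ((List.range M).map B) k s := by
  induction c with
  | zero => simp
  | succ c ih =>
    rw [← ih]
    cases M with
    | zero => simp
    | succ M =>
      have e1 : (List.range (M + 1)).map (fun j => B (c + j))
        = [B c] ++ (List.range M).map (fun j => B (c + 1 + j)) := by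
        rw [List.range_succ_eq_map, List.map_cons, List.map_map]
        simp only [add_zero, List.singleton_append, List.cons.injEq, true_and]
        apply List.map_congr_left
        intro j _
        simp only [Function.comp, Nat.succ_eq_add_one]
        congr 1; omega
      have e2 : (List.range (M + 1)).map (fun j => B (c + 1 + j))
        = (List.range M).map (fun j => B (c + 1 + j)) ++ [B c] := by
        rw [List.range_succ, List.map_append, List.map_singleton]
        congr 2
        rw [← hB c]; congr 1; omega
      rw [e1, e2, UC.rot]

theorem Run.ofSeq (B C X : ℕ → ℝ) (h1 : ∀ n, C (2 * n) = min (B (2 * n)) (X n))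
    (h2 : ∀ n, C (2 * n + 1) = B (2 * n) + B (2 * n + 1) - C (2 * n))
    (h3 : ∀ n, X (n + 1) = B (2 * n + 1) + X n - C (2 * n)) (n : ℕ) :
    Run (X 0) ((List.range (2 * n)).map B) ((List.range (2 * n)).map C) (X n) := by
  induction n with
  | zero => exact Run.nil _
  | succ n ih =>
    have e : ∀ D : ℕ → ℝ, (List.range (2 * (n + 1))).map D
        = (List.range (2 * n)).map D ++ [D (2 * n), D (2 * n + 1)] := by
      intro D
      rw [show 2 * (n + 1) = 2 * n + 1 + 1 by ring, List.range_succ, List.range_succ]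
      simp
    rw [e, e]
    apply ih.trans
    rw [h2, h1]
    apply Run.cons
    rw [← h1, ← h3]
    exact Run.nil _

theorem sum_window (N : ℕ) (f : ℤ → ℝ) (hf : ∀ n, f (n + N) = f n) (c : ℤ) :
    ∑ l ∈ Finset.range N, f (c + l) = ∑ l ∈ Finset.range N, f l := by
  have step : ∀ c : ℤ, ∑ l ∈ Finset.range N, f (c + 1 + l) = ∑ l ∈ Finset.range N, f (c + l) := by
    intro c
    have a := Finset.sum_range_succ (fun l : ℕ => f (c + l)) N
    have b := Finset.sum_range_succ' (fun l : ℕ => f (c + l)) N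
    rw [a] at b
    simp only [hf, Nat.cast_zero, add_zero] at b
    have b' := add_right_cancel b
    rw [b']
    apply Finset.sum_congr rfl
    intro l _
    congr 1; push_cast; ring
  induction c using Int.induction_on with
  | zero => simp
  | succ i ih => rw [step, ih]
  | pred i ih => rw [← ih, ← step]; simp

/-- The Young diagram produced by the generalized Kerov–Kirillov–Reshetikhin algorithm
(Algorithm A, applied to any even cyclic shift satisfying the highest weight condition)
is preserved under the time evolution of the tropical periodic Toda lattice. -/
theorem young_diagram_conserved (N : ℕ) (hN : 2 ≤ N)
    (A Abar : ZMod (2 * N) → ℝ) (hpos : ∀ n, 0 < A n)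
    (hphase : ∑ l ∈ Finset.range N, A ((2 * l + 2 : ℕ) : ZMod (2 * N))
      < ∑ l ∈ Finset.range N, A ((2 * l + 1 : ℕ) : ZMod (2 * N)))
    (hev1 : ∀ n : ℤ, Abar ((2 * n : ℤ) : ZMod (2 * N))
      = min (A ((2 * n + 1 : ℤ) : ZMod (2 * N)))
          (A ((2 * n : ℤ) : ZMod (2 * N)) -
            (Finset.range N).inf' (Finset.nonempty_range_iff.mpr (by omega))
              (fun k => ∑ l ∈ Finset.Icc 1 k,
                (A ((2 * (n - (l : ℤ)) + 1 : ℤ) : ZMod (2 * N))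
                  - A ((2 * (n - (l : ℤ)) : ℤ) : ZMod (2 * N))))))
    (hev2 : ∀ n : ℤ, Abar ((2 * n + 1 : ℤ) : ZMod (2 * N))
      = A ((2 * n + 1 : ℤ) : ZMod (2 * N)) + A ((2 * n + 2 : ℤ) : ZMod (2 * N))
        - Abar ((2 * n : ℤ) : ZMod (2 * N))) :
    ∀ m < N, HWC (shiftList N A m) → ∀ m' < N, HWC (shiftList N Abar m') →
      youngMS (shiftList N A m) = youngMS (shiftList N Abar m') := by
  intro m hm hA m' hm' hAb
  have hper : ∀ (n j : ℤ) , ((n + 2 * N * j : ℤ) : ZMod (2 * N)) = ((n : ℤ) : ZMod (2 * N)) := by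
    intro n j
    have : ((2 * N : ℕ) : ZMod (2 * N)) = 0 := ZMod.natCast_self _
    push_cast at this ⊢
    rw [this]; simp
  set d : ℤ → ℝ := fun n => A ((2 * n + 1 : ℤ) : ZMod (2 * N)) - A ((2 * n : ℤ) : ZMod (2 * N))
    with hd
  set I : ℤ → ℝ := fun n => (Finset.range N).inf' (Finset.nonempty_range_iff.mpr (by omega))
              (fun k => ∑ l ∈ Finset.Icc 1 k, d (n - (l : ℤ))) with hI
  have hoddp : ∀ n : ℤ, A ((2 * (n + N) + 1 : ℤ) : ZMod (2 * N)) = A ((2 * n + 1 : ℤ) : ZMod (2 * N)) := by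
    intro n
    rw [← hper (2 * n + 1) 1]; congr 2; ring
  have hevp : ∀ n : ℤ, A ((2 * (n + N) : ℤ) : ZMod (2 * N)) = A ((2 * n : ℤ) : ZMod (2 * N)) := by
    intro n
    rw [← hper (2 * n) 1]; congr 2; ring
  have hdp : ∀ n, d (n + N) = d n := by
    intro n; simp only [hd]; rw [hoddp, hevp]
  have hD : 0 < ∑ l ∈ Finset.range N, d l := by
    simp only [hd]
    rw [Finset.sum_sub_distrib]
    have := sum_window N (fun n => A ((2 * n : ℤ) : ZMod (2 * N))) hevp 1
    rw [← this]
    rw [sub_pos]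
    convert hphase using 2 with l _ l _
    · congr 1; push_cast; ring
    · congr 1; push_cast; ring
  have hDn : ∀ n, 0 < ∑ l ∈ Finset.Icc 1 N, d (n + 1 - (l : ℤ)) := by
    intro n
    have h1 : ∑ l ∈ Finset.Icc 1 N, d (n + 1 - (l : ℤ)) = ∑ l ∈ Finset.range N, d l := by
      rw [← sum_window N d hdp (n + 1 - N), ← Finset.sum_range_reflect,
        ← Finset.Ico_add_one_right_eq_Icc, Finset.sum_Ico_eq_sum_range]
      apply Finset.sum_congr (by simp)
      intro l hl
      have hl := Finset.mem_range.1 hl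
      congr 1
      rw [Nat.sub_sub, Nat.cast_sub (by omega)]
      push_cast; ring
    rw [h1]; exact hD
  have hsucc : ∀ (n : ℤ) (k : ℕ), ∑ l ∈ Finset.Icc 1 (k + 1), d (n + 1 - (l : ℤ))
      = d n + ∑ l ∈ Finset.Icc 1 k, d (n - (l : ℤ)) := by
    intro n k
    rw [← Finset.Ico_add_one_right_eq_Icc, Finset.sum_Ico_eq_sum_range,
      ← Finset.Ico_add_one_right_eq_Icc, Finset.sum_Ico_eq_sum_range]
    simp only [Nat.add_sub_cancel]
    rw [Finset.sum_range_succ', add_comm]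
    congr 1
    · congr 1; push_cast; ring
    · apply Finset.sum_congr rfl
      intro l _
      congr 1; push_cast; ring
  have hIrec : ∀ n, I (n + 1) = min 0 (d n + I n) := by
    intro n
    have z : I (n + 1) ≤ 0 := by
      have := Finset.inf'_le (s := Finset.range N) (fun k : ℕ => ∑ l ∈ Finset.Icc 1 k, d (n + 1 - (l : ℤ)))
        (show 0 ∈ Finset.range N by simp; omega)
      exact this.trans (by simp)
    apply le_antisymm
    · refine le_min z ?_
      rw [← sub_le_iff_le_add']
      apply Finset.le_inf'
      intro k hk
      have hk := Finset.mem_range.1 hk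
      rw [sub_le_iff_le_add', ← hsucc]
      rcases Nat.lt_or_ge (k + 1) N with h | h
      · exact Finset.inf'_le (s := Finset.range N) (fun k : ℕ => ∑ l ∈ Finset.Icc 1 k, d (n + 1 - (l : ℤ)))
          (show k + 1 ∈ Finset.range N by simpa using h)
      · obtain h : k + 1 = N := by omega
        rw [h]; exact z.trans (hDn n).le
    · apply Finset.le_inf'
      intro k hk
      have hk := Finset.mem_range.1 hk
      cases k with
      | zero => simp
      | succ k =>
        rw [hsucc]
        refine (min_le_right _ _).trans ?_
        apply add_le_add_right
        exact Finset.inf'_le (s := Finset.range N) (fun k : ℕ => ∑ l ∈ Finset.Icc 1 k, d (n - (l : ℤ)))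
          (show k ∈ Finset.range N by simp; omega)
  have hIp : I N = I 0 := by
    simp only [hI]
    congr 1
    funext k
    apply Finset.sum_congr rfl
    intro l _
    rw [← hdp (0 - l)]; congr 1; ring
  set X : ℕ → ℝ := fun n => A ((2 * n : ℤ) : ZMod (2 * N)) - I n with hX
  set B : ℕ → ℝ := fun n => A ((n + 1 : ℤ) : ZMod (2 * N)) with hB
  set C : ℕ → ℝ := fun n => Abar ((n : ℤ) : ZMod (2 * N)) with hC
  have h1 : ∀ n, C (2 * n) = min (B (2 * n)) (X n) := by
    intro n
    simp only [hC, hB, hX, hI, hd]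
    push_cast
    have := hev1 n
    push_cast at this
    exact this
  have h2 : ∀ n, C (2 * n + 1) = B (2 * n) + B (2 * n + 1) - C (2 * n) := by
    intro n
    simp only [hC, hB]
    have := hev2 n
    push_cast at this ⊢
    rw [this, show (2 * (n : ZMod (2 * N)) + 1 + 1) = 2 * n + 2 by ring]
  have h3 : ∀ n, X (n + 1) = B (2 * n + 1) + X n - C (2 * n) := by
    intro n
    rw [h1]
    have e1 : X (n + 1) = B (2 * n + 1) - I (n + 1) := by
      simp only [hX, hB]
      congr 2
    have e2 : B (2 * n) - X n = d n + I n := by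
      simp only [hX, hB, hd]
      push_cast; ring
    rw [e1, hIrec, ← e2]
    rcases le_total (B (2 * n)) (X n) with h | h
    · rw [min_eq_left h, min_eq_right (by linarith)]; ring
    · rw [min_eq_right h, min_eq_left (by linarith)]; ring
  have hXp : X N = X 0 := by
    simp only [hX]
    have := hevp 0
    simp only [zero_add] at this
    rw [this, hIp]; simp
  have hrun := Run.ofSeq B C X h1 h2 h3 N
  rw [hXp] at hrun
  have hcons := Run.conserved N _ _ _ (by simp) hrun
  have hBp : ∀ n, B (n + 2 * N) = B n := by
    intro n
    simp only [hB]
    rw [← hper (n + 1) 1]; congr 2; push_cast; ring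
  have hCp : ∀ n, C (n + 2 * N) = C n := by
    intro n
    simp only [hC]
    rw [← hper n 1]; congr 2; push_cast; ring
  have hl : ∀ (D : ZMod (2 * N) → ℝ) m, shiftList N D m
      = (List.range (2 * N)).map (fun j => D ((2 * m + 1 + j : ℕ) : ZMod (2 * N))) := by
    intro D m
    unfold shiftList
    rw [List.ofFn_eq_map, ← List.map_coe_finRange_eq_range, List.map_map]
    rfl
  have eA : shiftList N A m = (List.range (2 * N)).map (fun j => B (2 * m + j)) := by
    rw [hl]
    apply List.map_congr_left
    intro j _
    simp only [hB]
    congr 1; push_cast; ring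
  have eB : shiftList N Abar m' = (List.range (2 * N)).map (fun j => C (2 * m' + 1 + j)) := by
    rw [hl]
    apply List.map_congr_left
    intro j _
    simp only [hC]
    congr 1; push_cast; ring
  apply youngMS_eq N _ _ (by simp [shiftList]) (by simp [shiftList]) hA hAb
  intro k s
  rw [eA, eB, UC.window _ B hBp, UC.window _ C hCp]
  exact hcons k s
end
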